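/- Let n ≥ 2. Every partial proper edge coloring of at most n edges of the complete graph K_{2n−1} is extendable to a proper (2n−1)-edge coloring of K_{2n−1}. -/

import Mathlib

open SimpleGraph

variable {V : Type*}

/-- Two edges of `G` are adjacent if both are edges, they are distinct,
and they share a vertex. -/
def EdgeAdj (G : SimpleGraph V) (e f : Sym2 V) : Prop :=
  e ∈ G.edgeSet ∧ f ∈ G.edgeSet ∧ e ≠ f ∧ ∃ v, v ∈ e ∧ v ∈ f

/-- A proper edge coloring (with natural-number colors). -/
def IsProperEdgeColoring (G : SimpleGraph V) (C : Sym2 V → ℕ) : Prop :=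
  ∀ ⦃e f⦄, EdgeAdj G e f → C e ≠ C f

/-- A partial proper edge coloring: colored edges are edges of `G`, and
adjacent colored edges receive distinct colors. -/
def IsPartialProperEdgeColoring (G : SimpleGraph V) (φ : Sym2 V → Option ℕ) : Prop :=
  (∀ e, φ e ≠ none → e ∈ G.edgeSet) ∧
  ∀ ⦃e f⦄, EdgeAdj G e f → φ e ≠ none → φ e ≠ φ f

/-- The partial coloring uses colors from `{0, ..., t-1}`. -/
def UsesColors (φ : Sym2 V → Option ℕ) (t : ℕ) : Prop :=
  ∀ e a, φ e = some a → a < t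

/-- The (total) coloring uses colors from `{0, ..., t-1}` on all edges of `G`. -/
def ColorsBelow (G : SimpleGraph V) (C : Sym2 V → ℕ) (t : ℕ) : Prop :=
  ∀ e ∈ G.edgeSet, C e < t

/-- `C` agrees with the partial coloring `φ` on all precolored edges. -/
def ExtendsColoring (C : Sym2 V → ℕ) (φ : Sym2 V → Option ℕ) : Prop :=
  ∀ e a, φ e = some a → C e = a

/-- `φ` extends to a proper edge coloring of `G` with `t` colors. -/
def Extendable (G : SimpleGraph V) (φ : Sym2 V → Option ℕ) (t : ℕ) : Prop :=
  ∃ C, IsProperEdgeColoring G C ∧ ColorsBelow G C t ∧ ExtendsColoring C φ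

/-- The set of precolored edges of `φ`. -/
def Precolored (φ : Sym2 V → Option ℕ) : Set (Sym2 V) := {e | φ e ≠ none}

/-- The chromatic index: least `t` admitting a proper edge coloring with `t` colors. -/
noncomputable def chromaticIndex (G : SimpleGraph V) : ℕ :=
  sInf {t | ∃ C, IsProperEdgeColoring G C ∧ ColorsBelow G C t}

/-- A set of edges is independent (a matching) if no two distinct members share a vertex. -/
def IndependentEdges (S : Set (Sym2 V)) : Prop :=
  ∀ e ∈ S, ∀ f ∈ S, e ≠ f → ∀ v, v ∈ e → v ∉ f

open Finset in
/-- Hall's theorem with a prescribed set of colours to cover. -/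
theorem exists_matching_covering {X C : Type*} [DecidableEq X] [DecidableEq C] [Nonempty C]
    (R : Finset X) (P : Finset C) (N : X → Finset C) (hN : ∀ x ∈ R, N x ⊆ P)
    (Q : Finset C) (hQP : Q ⊆ P)
    (hR : ∀ A ⊆ R, #A ≤ #(A.biUnion N))
    (hQ : ∀ B ⊆ Q, #B ≤ #{x ∈ R | ∃ c ∈ B, c ∈ N x}) :
    ∃ M : X → C, Set.InjOn M R ∧ (∀ x ∈ R, M x ∈ N x) ∧ ∀ c ∈ Q, ∃ x ∈ R, M x = c := by
  classical
  have hRP : #R ≤ #P := (hR R subset_rfl).trans (card_le_card (biUnion_subset.2 hN))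
  let t : {x // x ∈ R} ⊕ Fin (#P - #R) → Finset C := Sum.elim (fun x => N x) (fun _ => P \ Q)
  have hall : ∀ s : Finset ({x // x ∈ R} ⊕ Fin (#P - #R)), #s ≤ #(s.biUnion t) := by
    intro s
    set A : Finset X := s.toLeft.map (Function.Embedding.subtype _) with hA
    have hAR : A ⊆ R := by
      intro x hx
      simp only [hA, mem_map, Function.Embedding.subtype_apply] at hx
      obtain ⟨y, -, rfl⟩ := hx
      exact y.2
    have hcard : #s = #A + #s.toRight := by
      rw [hA, card_map, card_toLeft_add_card_toRight]
    have hAN : A.biUnion N ⊆ s.biUnion t := by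
      intro c hc
      simp only [mem_biUnion, hA, mem_map, Function.Embedding.subtype_apply, mem_toLeft] at hc ⊢
      obtain ⟨x, ⟨y, hy, rfl⟩, hc⟩ := hc
      exact ⟨_, hy, hc⟩
    by_cases hB : s.toRight = ∅
    · rw [hcard, hB, card_empty, add_zero]
      exact (hR A hAR).trans (card_le_card hAN)
    · obtain ⟨i, hi⟩ := nonempty_iff_ne_empty.2 hB
      have hPQ : P \ Q ⊆ s.biUnion t := by
        intro c hc
        exact mem_biUnion.2 ⟨Sum.inr i, mem_toRight.1 hi, hc⟩
      have h1 : P \ (Q \ A.biUnion N) ⊆ s.biUnion t := by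
        intro c hc
        simp only [mem_sdiff, not_and, not_not] at hc
        by_cases hcQ : c ∈ Q
        · exact hAN (hc.2 hcQ)
        · exact hPQ (mem_sdiff.2 ⟨hc.1, hcQ⟩)
      have h2 : #(Q \ A.biUnion N) ≤ #(R \ A) := by
        refine (hQ _ sdiff_subset).trans (card_le_card ?_)
        intro x hx
        simp only [mem_filter, mem_sdiff] at hx ⊢
        obtain ⟨hx, c, ⟨-, hc⟩, hcx⟩ := hx
        exact ⟨hx, fun hxA => hc (mem_biUnion.2 ⟨x, hxA, hcx⟩)⟩
      have h3 := card_le_card h1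
      rw [card_sdiff_of_subset (sdiff_subset.trans hQP)] at h3
      rw [card_sdiff_of_subset hAR] at h2
      have h4 : #s.toRight ≤ #P - #R := by simpa using card_le_univ s.toRight
      have h5 := card_le_card hAR
      omega
  obtain ⟨f, hf, hft⟩ := (all_card_le_biUnion_card_iff_exists_injective t).1 hall
  have hfP : ∀ i, f i ∈ P := by
    rintro (x | i)
    · exact hN x x.2 (hft (Sum.inl x))
    · exact (mem_sdiff.1 (hft (Sum.inr i))).1
  have himg : univ.image f = P := by
    refine eq_of_subset_of_card_le (by intro c hc; obtain ⟨i, -, rfl⟩ := mem_image.1 hc; exact hfP i) ?_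
    rw [card_image_of_injective _ hf]
    simp
    omega
  refine ⟨fun x => if h : x ∈ R then f (Sum.inl ⟨x, h⟩) else Classical.arbitrary C, ?_, ?_, ?_⟩
  · intro x hx y hy hxy
    have hx' : x ∈ R := hx
    have hy' : y ∈ R := hy
    simp only [hx', hy', dif_pos] at hxy
    simpa using hf hxy
  · intro x hx
    have := hft (Sum.inl ⟨x, hx⟩)
    simpa [t, hx] using this
  · intro c hc
    have : c ∈ univ.image f := by rw [himg]; exact hQP hc
    obtain ⟨(x | i), -, rfl⟩ := mem_image.1 this
    · exact ⟨x, x.2, by simp⟩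
    · exact absurd hc (mem_sdiff.1 (hft (Sum.inr i))).2

open Finset in
/-- A matching covering the left side and `Q` exists in a bipartite graph with maximum degree
at most `d` whose deficiency, on either side, is less than `d`. -/
theorem exists_matching_of_degree {X C : Type*} [DecidableEq X] [DecidableEq C] [Nonempty C]
    (R : Finset X) (P : Finset C) (N : X → Finset C) (hN : ∀ x ∈ R, N x ⊆ P)
    (Q : Finset C) (hQP : Q ⊆ P) (d : ℕ)
    (hdR : ∀ x ∈ R, #(N x) ≤ d) (hdP : ∀ c ∈ P, #{x ∈ R | c ∈ N x} ≤ d)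
    (hR : ∀ A ⊆ R, d * #A < ∑ x ∈ A, #(N x) + d)
    (hQ : ∀ B ⊆ Q, d * #B < ∑ c ∈ B, #{x ∈ R | c ∈ N x} + d) :
    ∃ M : X → C, Set.InjOn M R ∧ (∀ x ∈ R, M x ∈ N x) ∧ ∀ c ∈ Q, ∃ x ∈ R, M x = c := by
  classical
  apply exists_matching_covering R P N hN Q hQP
  · intro A hA
    have h1 : ∑ x ∈ A, #(N x) ≤ d * #(A.biUnion N) := by
      calc ∑ x ∈ A, #(N x) = ∑ x ∈ A, #{c ∈ A.biUnion N | c ∈ N x} := by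
            refine sum_congr rfl fun x hx => congrArg _ ?_
            ext c
            simp only [mem_filter, mem_biUnion]
            exact ⟨fun h => ⟨⟨x, hx, h⟩, h⟩, fun h => h.2⟩
        _ = ∑ c ∈ A.biUnion N, #{x ∈ A | c ∈ N x} :=
            sum_card_bipartiteAbove_eq_sum_card_bipartiteBelow (fun x c => c ∈ N x)
        _ ≤ ∑ c ∈ A.biUnion N, d := by
            refine sum_le_sum fun c hc => ?_
            refine (card_le_card (filter_subset_filter _ hA)).trans (hdP c ?_)
            obtain ⟨x, hx, hc⟩ := mem_biUnion.1 hc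
            exact hN x (hA hx) hc
        _ = d * #(A.biUnion N) := by rw [sum_const, smul_eq_mul, mul_comm]
    have h2 := hR A hA
    have h3 : d * #A < d * (#(A.biUnion N) + 1) := by rw [mul_add]; omega
    exact Nat.lt_succ_iff.1 (lt_of_mul_lt_mul_left h3 (Nat.zero_le d))
  · intro B hB
    set Y := {x ∈ R | ∃ c ∈ B, c ∈ N x} with hY
    have h1 : ∑ c ∈ B, #{x ∈ R | c ∈ N x} ≤ d * #Y := by
      calc ∑ c ∈ B, #{x ∈ R | c ∈ N x} = ∑ c ∈ B, #{x ∈ Y | c ∈ N x} := by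
            refine sum_congr rfl fun c hc => congrArg _ ?_
            ext x
            simp only [hY, mem_filter]
            exact ⟨fun h => ⟨⟨h.1, c, hc, h.2⟩, h.2⟩, fun h => ⟨h.1.1, h.2⟩⟩
        _ = ∑ x ∈ Y, #{c ∈ B | c ∈ N x} :=
            sum_card_bipartiteAbove_eq_sum_card_bipartiteBelow (fun c x => c ∈ N x)
        _ ≤ ∑ x ∈ Y, d := by
            refine sum_le_sum fun x hx => ?_
            refine (card_le_card ?_).trans (hdR x (mem_filter.1 hx).1)
            intro c hc
            exact (mem_filter.1 hc).2
        _ = d * #Y := by rw [sum_const, smul_eq_mul, mul_comm]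
    have h2 := hQ B hB
    have h3 : d * #B < d * (#Y + 1) := by rw [mul_add]; omega
    exact Nat.lt_succ_iff.1 (lt_of_mul_lt_mul_left h3 (Nat.zero_le d))

section Basics

open Finset

variable {α : Type*} {χ : Sym2 V → α} {R : Finset V} {P : Finset α} {c : α} {w x : V} {M : V → α}

/-- `χ` restricts to a proper edge coloring, with colours in `P`, of the complete graph on `R`. -/
structure ProperOn (χ : Sym2 V → α) (R : Finset V) (P : Finset α) : Prop where
  mem : ∀ x ∈ R, ∀ y ∈ R, x ≠ y → χ s(x, y) ∈ P
  ne : ∀ x ∈ R, ∀ y ∈ R, ∀ z ∈ R, x ≠ y → x ≠ z → y ≠ z → χ s(x, y) ≠ χ s(x, z)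

theorem ProperOn.eq_of_eq (h : ProperOn χ R P) {y z : V} (hx : x ∈ R) (hy : y ∈ R) (hz : z ∈ R)
    (hxy : x ≠ y) (hxz : x ≠ z) (he : χ s(x, y) = χ s(x, z)) : y = z := by
  by_contra hne
  exact h.ne x hx y hy z hz hxy hxz hne he

variable [DecidableEq V]

/-- Extend a coloring to the edges at `w`, giving the edge from `w` to `x` the colour `M x`. -/
def addVertex (χ : Sym2 V → α) (w : V) (M : V → α) : Sym2 V → α :=
  Sym2.lift ⟨fun x y => if x = w then M y else if y = w then M x else χ s(x, y), by
    intro x y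
    dsimp only
    split_ifs with h1 h2 h2
    · rw [h1, h2]
    · rfl
    · rfl
    · rw [Sym2.eq_swap]⟩

theorem addVertex_left (y : V) : addVertex χ w M s(w, y) = M y := by
  simp [addVertex]

theorem addVertex_right (hx : x ≠ w) : addVertex χ w M s(x, w) = M x := by
  simp [addVertex, hx]

theorem addVertex_of_ne {y : V} (hx : x ≠ w) (hy : y ≠ w) :
    addVertex χ w M s(x, y) = χ s(x, y) := by
  simp [addVertex, hx, hy]

variable [DecidableEq α]

/-- The colours of `P` missing at `x` in the complete graph on `R`. -/
def freeColors (χ : Sym2 V → α) (R : Finset V) (P : Finset α) (x : V) : Finset α :=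
  {c ∈ P | ∀ y ∈ R, y ≠ x → χ s(x, y) ≠ c}

/-- The vertices of `R` at which the colour `c` is missing. -/
def missing (χ : Sym2 V → α) (R : Finset V) (c : α) : Finset V :=
  {x ∈ R | ∀ y ∈ R, y ≠ x → χ s(x, y) ≠ c}

theorem mem_freeColors :
    c ∈ freeColors χ R P x ↔ c ∈ P ∧ ∀ y ∈ R, y ≠ x → χ s(x, y) ≠ c := by
  simp [freeColors]

theorem mem_missing :
    x ∈ missing χ R c ↔ x ∈ R ∧ ∀ y ∈ R, y ≠ x → χ s(x, y) ≠ c := by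
  simp [missing]

theorem missing_subset : missing χ R c ⊆ R := filter_subset _ _

theorem freeColors_subset : freeColors χ R P x ⊆ P := filter_subset _ _

theorem filter_mem_freeColors (hc : c ∈ P) :
    {x ∈ R | c ∈ freeColors χ R P x} = missing χ R c := by
  ext x
  simp [mem_freeColors, mem_missing, hc]

theorem ProperOn.card_freeColors (h : ProperOn χ R P) (hx : x ∈ R) :
    #(freeColors χ R P x) + #R = #P + 1 := by
  have h1 : freeColors χ R P x = P \ (R.erase x).image (fun y => χ s(x, y)) := by
    ext c
    simp only [mem_freeColors, mem_sdiff, mem_image, mem_erase, not_exists, not_and]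
    exact ⟨fun h => ⟨h.1, fun y hy => h.2 y hy.2 hy.1⟩, fun h => ⟨h.1, fun y hy hyx => h.2 y ⟨hyx, hy⟩⟩⟩
  have h2 : (R.erase x).image (fun y => χ s(x, y)) ⊆ P := by
    intro c hc
    obtain ⟨y, hy, rfl⟩ := mem_image.1 hc
    rw [mem_erase] at hy
    exact h.mem x hx y hy.2 hy.1.symm
  have h3 : #((R.erase x).image (fun y => χ s(x, y))) = #R - 1 := by
    rw [card_image_of_injOn, card_erase_of_mem hx]
    intro y hy z hz hyz
    simp only [coe_erase, Set.mem_sdiff, mem_coe, Set.mem_singleton_iff] at hy hz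
    by_contra hne
    exact h.ne x hx y hy.1 z hz.1 (Ne.symm hy.2) (Ne.symm hz.2) hne hyz
  have h4 := card_le_card h2
  rw [h1, card_sdiff_of_subset h2, h3]
  have : 0 < #R := card_pos.2 ⟨x, hx⟩
  omega

theorem ProperOn.card_missing_mod_two (h : ProperOn χ R P) (c : α) :
    #(missing χ R c) % 2 = #R % 2 := by
  have h1 : ∀ x ∈ R \ missing χ R c, ∃ y ∈ R \ missing χ R c, y ≠ x ∧ χ s(x, y) = c := by
    intro x hx
    simp only [mem_sdiff, mem_missing, not_and, not_forall, not_not] at hx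
    obtain ⟨y, hy, hyx, hc⟩ := hx.2 hx.1
    refine ⟨y, ?_, hyx, hc⟩
    simp only [mem_sdiff, mem_missing, not_and, not_forall, not_not]
    exact ⟨hy, fun _ => ⟨x, hx.1, hyx.symm, by rw [Sym2.eq_swap]; exact hc⟩⟩
  choose! f hf hfne hfc using h1
  have h2 : ∑ _x ∈ R \ missing χ R c, (1 : ZMod 2) = 0 := by
    refine sum_involution (fun x _ => f x) (fun _ _ => by decide) (fun x hx _ => hfne x hx)
      (fun x hx => hf x hx) ?_
    intro x hx
    have hx1 := (mem_sdiff.1 hx).1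
    have hx2 := (mem_sdiff.1 (hf x hx)).1
    have hx3 := (mem_sdiff.1 (hf _ (hf x hx))).1
    refine h.eq_of_eq hx2 hx3 hx1 (hfne _ (hf x hx)).symm (hfne x hx) ?_
    rw [hfc _ (hf x hx), Sym2.eq_swap, hfc x hx]
  rw [sum_const, nsmul_eq_mul, mul_one, ZMod.natCast_eq_zero_iff,
    card_sdiff_of_subset missing_subset] at h2
  have := card_le_card (missing_subset (χ := χ) (R := R) (c := c))
  omega

theorem sum_card_filter_mem_freeColors (A : Finset V) (B : Finset α) :
    ∑ c ∈ B, #{x ∈ A | c ∈ freeColors χ R P x} = ∑ x ∈ A, #(freeColors χ R P x ∩ B) := by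
  change ∑ c ∈ B, #(bipartiteBelow (fun x c => c ∈ freeColors χ R P x) A c) = _
  rw [← sum_card_bipartiteAbove_eq_sum_card_bipartiteBelow (s := A) (t := B)
    (fun x c => c ∈ freeColors χ R P x)]
  refine sum_congr rfl fun x _ => congrArg _ ?_
  ext c
  simp only [bipartiteAbove, mem_filter, mem_inter]
  tauto

theorem ProperOn.proper_addVertex (h : ProperOn χ R P) (hw : w ∉ R) (hM : Set.InjOn M R)
    (hf : ∀ x ∈ R, M x ∈ freeColors χ R P x) :
    ProperOn (addVertex χ w M) (insert w R) P := by
  have hne : ∀ {x}, x ∈ R → x ≠ w := fun hx he => hw (he ▸ hx)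
  constructor
  · intro x hx y hy hxy
    rcases mem_insert.1 hx with rfl | hx'
    · rcases mem_insert.1 hy with rfl | hy'
      · exact absurd rfl hxy
      · rw [addVertex_left]; exact (mem_freeColors.1 (hf y hy')).1
    · rcases mem_insert.1 hy with rfl | hy'
      · rw [addVertex_right hxy]; exact (mem_freeColors.1 (hf x hx')).1
      · rw [addVertex_of_ne (hne hx') (hne hy')]; exact h.mem x hx' y hy' hxy
  · intro x hx y hy z hz hxy hxz hyz
    rcases mem_insert.1 hx with rfl | hx'
    · have hy' := mem_of_mem_insert_of_ne hy hxy.symm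
      have hz' := mem_of_mem_insert_of_ne hz hxz.symm
      rw [addVertex_left, addVertex_left]
      exact fun he => hyz (hM hy' hz' he)
    · rcases mem_insert.1 hy with rfl | hy'
      · have hz' := mem_of_mem_insert_of_ne hz hyz.symm
        rw [addVertex_right hxy, addVertex_of_ne (hne hx') (hne hz')]
        exact ((mem_freeColors.1 (hf x hx')).2 z hz' hxz.symm).symm
      · rcases mem_insert.1 hz with rfl | hz'
        · rw [addVertex_right hxz, addVertex_of_ne (hne hx') (hne hy')]
          exact (mem_freeColors.1 (hf x hx')).2 y hy' hxy.symm
        · rw [addVertex_of_ne (hne hx') (hne hy'), addVertex_of_ne (hne hx') (hne hz')]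
          exact h.ne x hx' y hy' z hz' hxy hxz hyz

theorem mem_freeColors_addVertex (hw : w ∉ R) (hx : x ∈ R) :
    c ∈ freeColors (addVertex χ w M) (insert w R) P x ↔ c ∈ freeColors χ R P x ∧ M x ≠ c := by
  have hne : ∀ {x}, x ∈ R → x ≠ w := fun hx he => hw (he ▸ hx)
  simp only [mem_freeColors]
  constructor
  · rintro ⟨h1, h2⟩
    refine ⟨⟨h1, fun y hy hyx => ?_⟩, ?_⟩
    · rw [← addVertex_of_ne (χ := χ) (M := M) (hne hx) (hne hy)]
      exact h2 y (mem_insert_of_mem hy) hyx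
    · rw [← addVertex_right (χ := χ) (M := M) (hne hx)]
      exact h2 w (mem_insert_self _ _) (hne hx).symm
  · rintro ⟨⟨h1, h2⟩, h3⟩
    refine ⟨h1, fun y hy hyx => ?_⟩
    rcases mem_insert.1 hy with rfl | hy
    · rw [addVertex_right (hne hx)]; exact h3
    · rw [addVertex_of_ne (hne hx) (hne hy)]; exact h2 y hy hyx

theorem mem_freeColors_addVertex_self (hw : w ∉ R) :
    c ∈ freeColors (addVertex χ w M) (insert w R) P w ↔ c ∈ P ∧ ∀ x ∈ R, M x ≠ c := by
  have hne : ∀ {x}, x ∈ R → x ≠ w := fun hx he => hw (he ▸ hx)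
  simp only [mem_freeColors, addVertex_left]
  refine and_congr_right fun _ => ⟨fun h x hx => h x (mem_insert_of_mem hx) (hne hx),
    fun h x hx hxw => h x (mem_of_mem_insert_of_ne hx hxw)⟩

theorem missing_eq_filter (hc : c ∈ P) :
    missing χ R c = {x ∈ R | c ∈ freeColors χ R P x} := (filter_mem_freeColors hc).symm

theorem missing_addVertex_of_mem (hc : c ∈ P) (hw : w ∉ R) (hM : Set.InjOn M R) (hx : x ∈ R)
    (hxc : M x = c) :
    missing (addVertex χ w M) (insert w R) c = (missing χ R c).erase x := by
  rw [missing_eq_filter hc, missing_eq_filter hc]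
  ext y
  simp only [mem_filter, mem_erase, mem_insert]
  constructor
  · rintro ⟨rfl | hy, h⟩
    · exact absurd hxc ((mem_freeColors_addVertex_self hw).1 h |>.2 x hx)
    · rw [mem_freeColors_addVertex hw hy] at h
      exact ⟨fun he => h.2 (he ▸ hxc), hy, h.1⟩
  · rintro ⟨hyx, hy, h⟩
    refine ⟨Or.inr hy, (mem_freeColors_addVertex hw hy).2 ⟨h, fun he => hyx ?_⟩⟩
    exact hM hy hx (he.trans hxc.symm)

theorem missing_addVertex_of_notMem (hc : c ∈ P) (hw : w ∉ R) (hx : ∀ x ∈ R, M x ≠ c) :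
    missing (addVertex χ w M) (insert w R) c = insert w (missing χ R c) := by
  rw [missing_eq_filter hc, missing_eq_filter hc]
  ext y
  simp only [mem_filter, mem_insert]
  constructor
  · rintro ⟨rfl | hy, h⟩
    · exact Or.inl rfl
    · rw [mem_freeColors_addVertex hw hy] at h
      exact Or.inr ⟨hy, h.1⟩
  · rintro (rfl | ⟨hy, h⟩)
    · exact ⟨Or.inl rfl, (mem_freeColors_addVertex_self hw).2 ⟨hc, hx⟩⟩
    · exact ⟨Or.inr hy, (mem_freeColors_addVertex hw hy).2 ⟨h, hx y hy⟩⟩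

theorem card_missing_addVertex_of_mem (hc : c ∈ P) (hw : w ∉ R) (hM : Set.InjOn M R)
    (hf : ∀ x ∈ R, M x ∈ freeColors χ R P x) (hx : ∃ x ∈ R, M x = c) :
    #(missing (addVertex χ w M) (insert w R) c) + 1 = #(missing χ R c) := by
  obtain ⟨x, hx, hxc⟩ := hx
  rw [missing_addVertex_of_mem hc hw hM hx hxc]
  apply card_erase_add_one
  rw [missing_eq_filter hc, mem_filter]
  exact ⟨hx, hxc ▸ hf x hx⟩

theorem card_missing_addVertex_of_notMem (hc : c ∈ P) (hw : w ∉ R) (hx : ¬ ∃ x ∈ R, M x = c) :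
    #(missing (addVertex χ w M) (insert w R) c) = #(missing χ R c) + 1 := by
  push Not at hx
  rw [missing_addVertex_of_notMem hc hw hx]
  exact card_insert_of_notMem fun h => hw (missing_subset h)

end Basics

section Extension

open Finset

variable {α : Type*} [DecidableEq V] [DecidableEq α] [Nonempty α]
  {χ : Sym2 V → α} {R U : Finset V} {P : Finset α}

/-- A proper coloring of the complete graph on `R` in which no colour is missing at too many
vertices extends to the complete graph on `U`. -/
theorem ProperOn.exists_extension (hU : #U = #P) (hodd : #P % 2 = 1) (k : ℕ) :
    ∀ (R : Finset V) (χ : Sym2 V → α), R ⊆ U → #(U \ R) = k → ProperOn χ R P →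
      (∀ c ∈ P, #(missing χ R c) + #R ≤ #P + 1) →
      ∃ χ' : Sym2 V → α, ProperOn χ' U P ∧
        ∀ x ∈ R, ∀ y ∈ R, x ≠ y → χ' s(x, y) = χ s(x, y) := by
  induction k with
  | zero =>
    intro R χ hRU hk hχ _
    obtain rfl : R = U := hRU.antisymm (sdiff_eq_empty_iff_subset.1 (card_eq_zero.1 hk))
    exact ⟨χ, hχ, fun _ _ _ _ _ => rfl⟩
  | succ k ih =>
    intro R χ hRU hk hχ hmiss
    obtain ⟨w, hw⟩ : (U \ R).Nonempty := card_pos.1 (by omega)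
    rw [mem_sdiff] at hw
    have hRc : #R + (k + 1) = #P := by
      rw [← hU, ← hk, add_comm, card_sdiff_add_card_eq_card hRU]
    have hpar : ∀ c, #(missing χ R c) % 2 = #R % 2 := hχ.card_missing_mod_two
    have hfree : ∀ x ∈ R, #(freeColors χ R P x) = #P + 1 - #R := fun x hx => by
      have := hχ.card_freeColors hx
      omega
    obtain ⟨M, hM, hf, hQ⟩ := exists_matching_of_degree R P (freeColors χ R P)
      (fun x _ => freeColors_subset) {c ∈ P | #(missing χ R c) = #P + 1 - #R}
      (filter_subset _ _) (#P + 1 - #R) (fun x hx => (hfree x hx).le)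
      (fun c hc => by rw [filter_mem_freeColors hc]; have := hmiss c hc; omega)
      (fun A hA => by
        rw [sum_congr rfl fun x hx => hfree x (hA hx), sum_const, smul_eq_mul, mul_comm]
        omega)
      (fun B hB => by
        rw [sum_congr rfl fun c hc => (?_ : _ = #P + 1 - #R), sum_const, smul_eq_mul, mul_comm]
        · omega
        · have := mem_filter.1 (hB hc)
          rw [filter_mem_freeColors this.1, this.2])
    obtain ⟨χ', h1, h2⟩ := ih (insert w R) (addVertex χ w M) (insert_subset hw.1 hRU)
      (by rw [sdiff_insert, card_erase_of_mem (mem_sdiff.2 hw)]; omega)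
      (hχ.proper_addVertex hw.2 hM hf) (fun c hc => by
        rw [card_insert_of_notMem hw.2]
        have h3 := hmiss c hc
        have h4 := hpar c
        by_cases h : ∃ x ∈ R, M x = c
        · have := card_missing_addVertex_of_mem hc hw.2 hM hf h
          omega
        · have h5 : #(missing χ R c) ≠ #P + 1 - #R := fun h6 => h (hQ c (mem_filter.2 ⟨hc, h6⟩))
          rw [card_missing_addVertex_of_notMem hc hw.2 h]
          omega)
    refine ⟨χ', h1, fun x hx y hy hxy => ?_⟩
    rw [h2 x (mem_insert_of_mem hx) y (mem_insert_of_mem hy) hxy,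
      addVertex_of_ne (ne_of_mem_of_not_mem hx hw.2) (ne_of_mem_of_not_mem hy hw.2)]

end Extension

section TwoFactor

open Finset

/-- If no rectangle contains too many items, the items can be split into two parts so that the
fibres of `γ` on the first part and of `ν` on the second part have bounded size. -/
theorem exists_subset_card_fiber_le {ι C K : Type*} [DecidableEq ι] [DecidableEq C] [DecidableEq K]
    (I : Finset ι) (γ : ι → C) (ν : ι → K) (u : C → ℕ) (r : K → ℕ)
    (h : ∀ (A : Finset C) (B : Finset K), A ⊆ I.image γ → B ⊆ I.image ν →
      #{i ∈ I | γ i ∈ A ∧ ν i ∈ B} ≤ ∑ c ∈ A, u c + ∑ k ∈ B, r k) :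
    ∃ J ⊆ I, (∀ c, #{i ∈ I \ J | γ i = c} ≤ u c) ∧ ∀ k, #{i ∈ J | ν i = k} ≤ r k := by
  classical
  let t : {i // i ∈ I} → Finset ((Σ _ : C, ℕ) ⊕ (Σ _ : K, ℕ)) := fun i =>
    (({γ i} : Finset C).sigma fun c => range (u c)).disjSum
      (({ν i} : Finset K).sigma fun k => range (r k))
  have hall : ∀ s : Finset {i // i ∈ I}, #s ≤ #(s.biUnion t) := by
    intro s
    have h1 : s.biUnion t = ((s.image fun i : {i // i ∈ I} => γ i).sigma fun c => range (u c)).disjSum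
        ((s.image fun i : {i // i ∈ I} => ν i).sigma fun k => range (r k)) := by
      ext (⟨c, j⟩ | ⟨k, j⟩)
      · simp only [t, mem_biUnion, inl_mem_disjSum, mem_sigma, mem_singleton, mem_image]
        grind
      · simp only [t, mem_biUnion, inr_mem_disjSum, mem_sigma, mem_singleton, mem_image]
        grind
    have h2 := h (s.image fun i : {i // i ∈ I} => γ i) (s.image fun i : {i // i ∈ I} => ν i)
      (by intro c hc; obtain ⟨i, _, rfl⟩ := mem_image.1 hc; exact mem_image_of_mem _ i.2)
      (by intro c hc; obtain ⟨i, _, rfl⟩ := mem_image.1 hc; exact mem_image_of_mem _ i.2)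
    rw [h1, card_disjSum, card_sigma, card_sigma]
    simp only [card_range]
    refine le_trans ?_ h2
    rw [← card_map (Function.Embedding.subtype _) (s := s)]
    refine card_le_card fun i hi => ?_
    obtain ⟨j, hj, rfl⟩ := mem_map.1 hi
    exact mem_filter.2 ⟨j.2, mem_image_of_mem (fun i : {i // i ∈ I} => γ i) hj,
      mem_image_of_mem (fun i : {i // i ∈ I} => ν i) hj⟩
  obtain ⟨f, hf, hft⟩ := (all_card_le_biUnion_card_iff_exists_injective t).1 hall
  refine ⟨{i ∈ I | ∃ h : i ∈ I, (f ⟨i, h⟩).isRight}, filter_subset _ _, fun c => ?_, fun k => ?_⟩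
  · have : ∀ i ∈ {i ∈ I \ {i ∈ I | ∃ h : i ∈ I, (f ⟨i, h⟩).isRight} | γ i = c},
        ∃ j : ℕ, j < u c ∧ ∃ h : i ∈ I, f ⟨i, h⟩ = Sum.inl ⟨c, j⟩ := by
      intro i hi
      simp only [mem_filter, mem_sdiff, not_and, not_exists] at hi
      obtain ⟨⟨hi, h1⟩, rfl⟩ := hi
      have h2 := h1 hi hi
      have h3 := hft ⟨i, hi⟩
      rcases h4 : f ⟨i, hi⟩ with ⟨c, j⟩ | p
      · rw [h4] at h3
        simp only [t, inl_mem_disjSum, mem_sigma, mem_singleton, mem_range] at h3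
        obtain ⟨rfl, h3⟩ := h3
        exact ⟨j, h3, hi, h4⟩
      · simp [h4] at h2
    choose! g hg using this
    refine (card_le_card_of_injOn g (t := range (u c)) (fun i hi => ?_) ?_).trans (card_range _).le
    · obtain ⟨h, _⟩ := hg i hi
      exact mem_coe.2 (mem_range.2 h)
    · intro i hi j hj hij
      obtain ⟨-, hi', h1⟩ := hg i hi
      obtain ⟨-, hj', h2⟩ := hg j hj
      rw [hij, ← h2] at h1
      exact congrArg Subtype.val (hf h1)
  · have : ∀ i ∈ {i ∈ {i ∈ I | ∃ h : i ∈ I, (f ⟨i, h⟩).isRight} | ν i = k},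
        ∃ j : ℕ, j < r k ∧ ∃ h : i ∈ I, f ⟨i, h⟩ = Sum.inr ⟨k, j⟩ := by
      intro i hi
      simp only [mem_filter] at hi
      obtain ⟨⟨hi, _, h1⟩, rfl⟩ := hi
      have h3 := hft ⟨i, hi⟩
      rcases h4 : f ⟨i, hi⟩ with p | ⟨c, j⟩
      · simp [h4] at h1
      · rw [h4] at h3
        simp only [t, inr_mem_disjSum, mem_sigma, mem_singleton, mem_range] at h3
        obtain ⟨rfl, h3⟩ := h3
        exact ⟨j, h3, hi, h4⟩
    choose! g hg using this
    refine (card_le_card_of_injOn g (t := range (r k)) (fun i hi => ?_) ?_).trans (card_range _).le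
    · obtain ⟨h, _⟩ := hg i hi
      exact mem_coe.2 (mem_range.2 h)
    · intro i hi j hj hij
      obtain ⟨-, hi', h1⟩ := hg i hi
      obtain ⟨-, hj', h2⟩ := hg j hj
      rw [hij, ← h2] at h1
      exact congrArg Subtype.val (hf h1)

/-- A bipartite graph in which left vertices have degree two and right vertices have degree at
most two splits into two matchings. -/
theorem exists_two_matchings {X C : Type*} [DecidableEq X] [DecidableEq C] [Nonempty C]
    (R : Finset X) (P : Finset C) (N : X → Finset C) (hN : ∀ x ∈ R, N x ⊆ P)
    (hR : ∀ x ∈ R, #(N x) = 2) (hP : ∀ c ∈ P, #{x ∈ R | c ∈ N x} ≤ 2) :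
    ∃ M₁ M₂ : X → C, Set.InjOn M₁ R ∧ Set.InjOn M₂ R ∧
      (∀ x ∈ R, M₁ x ∈ N x ∧ M₂ x ∈ N x ∧ M₁ x ≠ M₂ x) ∧
      (∀ c ∈ P, #{x ∈ R | c ∈ N x} = 2 → (∃ x ∈ R, M₁ x = c) ∧ ∃ x ∈ R, M₂ x = c) ∧
      ∀ c ∈ P, 1 ≤ #{x ∈ R | c ∈ N x} → (∃ x ∈ R, M₁ x = c) ∨ ∃ x ∈ R, M₂ x = c := by
  obtain ⟨M₁, hM, hMN, hMQ⟩ := exists_matching_of_degree R P N hN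
    {c ∈ P | #{x ∈ R | c ∈ N x} = 2} (filter_subset _ _) 2 (fun x hx => (hR x hx).le) hP
    (fun A hA => by
      rw [sum_congr rfl fun x hx => hR x (hA hx), sum_const, smul_eq_mul, mul_comm]
      omega)
    (fun B hB => by
      rw [sum_congr rfl fun c hc => (mem_filter.1 (hB hc)).2, sum_const, smul_eq_mul, mul_comm]
      omega)
  have : ∀ x ∈ R, ∃ c ∈ N x, c ≠ M₁ x ∧ ∀ c' ∈ N x, c' = c ∨ c' = M₁ x := by
    intro x hx
    obtain ⟨a, b, hab, he⟩ := card_eq_two.1 (hR x hx)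
    have := hMN x hx
    rw [he, mem_insert, mem_singleton] at this
    rw [he]
    rcases this with h | h
    · exact ⟨b, by simp, by rw [h]; exact hab.symm, by simp [h, or_comm]⟩
    · exact ⟨a, by simp, by rw [h]; exact hab, by simp [h]⟩
  choose! M₂ h2N h2ne h2 using this
  have key : ∀ c ∈ P, #{x ∈ R | c ∈ N x} = 2 → ∀ x ∈ R, ∀ y ∈ R, x ≠ y → c ∈ N x → c ∈ N y →
      M₁ x = c ∨ M₁ y = c := by
    intro c hc hc2 x hx y hy hxy hcx hcy
    obtain ⟨z, hz, hzc⟩ := hMQ c (mem_filter.2 ⟨hc, hc2⟩)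
    obtain ⟨a, b, hab, he⟩ := card_eq_two.1 hc2
    have hx' : x ∈ ({a, b} : Finset X) := he ▸ mem_filter.2 ⟨hx, hcx⟩
    have hy' : y ∈ ({a, b} : Finset X) := he ▸ mem_filter.2 ⟨hy, hcy⟩
    have hz' : z ∈ ({a, b} : Finset X) := he ▸ mem_filter.2 ⟨hz, hzc ▸ hMN z hz⟩
    simp only [mem_insert, mem_singleton] at hx' hy' hz'
    grind
  refine ⟨M₁, M₂, hM, ?_, fun x hx => ⟨hMN x hx, h2N x hx, (h2ne x hx).symm⟩, ?_, ?_⟩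
  · intro x hx y hy hxy
    by_contra hne
    have hc := hN x hx (h2N x hx)
    have hy2 : M₂ x ∈ N y := hxy ▸ h2N y hy
    have h3 : #{z ∈ R | M₂ x ∈ N z} = 2 := by
      refine le_antisymm (hP _ hc) ?_
      rw [← card_pair hne]
      refine card_le_card fun z hz => ?_
      rw [mem_insert, mem_singleton] at hz
      rcases hz with rfl | rfl
      · exact mem_filter.2 ⟨hx, h2N _ hx⟩
      · exact mem_filter.2 ⟨hy, hy2⟩
    rcases key _ hc h3 x hx y hy hne (h2N x hx) hy2 with h | h
    · exact h2ne x hx h.symm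
    · exact h2ne y hy (hxy.symm.trans h.symm)
  · intro c hc hc2
    refine ⟨hMQ c (mem_filter.2 ⟨hc, hc2⟩), ?_⟩
    obtain ⟨a, b, hab, he⟩ := card_eq_two.1 hc2
    have ha : a ∈ {x ∈ R | c ∈ N x} := by simp [he]
    have hb : b ∈ {x ∈ R | c ∈ N x} := by simp [he]
    rw [mem_filter] at ha hb
    rcases h2 a ha.1 c ha.2 with h | h
    · exact ⟨a, ha.1, h.symm⟩
    · rcases h2 b hb.1 c hb.2 with h' | h'
      · exact ⟨b, hb.1, h'.symm⟩
      · exact absurd (hM ha.1 hb.1 (h.symm.trans h')) hab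
  · intro c hc hc1
    obtain ⟨x, hx⟩ := card_pos.1 hc1
    rw [mem_filter] at hx
    rcases h2 x hx.1 c hx.2 with h | h
    · exact Or.inr ⟨x, hx.1, h.symm⟩
    · exact Or.inl ⟨x, hx.1, h.symm⟩

end TwoFactor

section TwoFactor

open Finset

theorem two_mul_le_of_slack {d n a e x m h : ℕ} (h1 : e + m + 2 * h + 2 * a = d * n)
    (h2 : m ≤ d * x) (h3 : 2 * h + 3 ≤ d) (h4 : d = 3 → a ≤ 2) :
    2 * n ≤ a + e + 2 * x := by
  by_contra! hlt
  rcases Nat.lt_or_ge 3 d with hd | hd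
  · obtain ⟨d, rfl⟩ := Nat.exists_eq_add_of_le hd
    obtain ⟨j, hj⟩ := Nat.exists_eq_add_of_lt (show a + 2 * x < 2 * n by omega)
    have h5 : (2 + d) * (j + 1) + d * a ≤ 2 * d := by nlinarith
    rcases Nat.eq_zero_or_pos j with rfl | hj0
    · have : 1 ≤ a := by omega
      nlinarith
    · nlinarith
  · have hd3 : d = 3 := by omega
    subst hd3
    have := h4 rfl
    omega

theorem two_mul_add_le_of_deficiency {d q a e : ℕ} (hd : 2 ≤ d)
    (h : d * a + 2 ≤ e + d * q + d) : 2 * a ≤ e + 2 * q := by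
  rcases Nat.lt_or_ge q a with h1 | h1
  · obtain ⟨j, rfl⟩ := Nat.exists_eq_add_of_lt h1
    nlinarith
  · omega

/-- In a bipartite graph whose left vertices have degree almost `d`, there are two disjoint
matchings of the left side that both cover the right vertices without slack, and at least one of
which covers the right vertices with slack one. -/
theorem exists_two_matchings_of_slack {X C : Type*} [DecidableEq X] [DecidableEq C] [Nonempty C]
    (R : Finset X) (P : Finset C) (N : X → Finset C) (hN : ∀ x ∈ R, N x ⊆ P) (d : ℕ)
    (h s : C → ℕ) (hcard : #P + 2 = #R + d) (hdR : ∀ x ∈ R, #(N x) ≤ d)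
    (hdef : ∀ A ⊆ R, d * #A + 2 ≤ ∑ x ∈ A, #(N x) + d)
    (hdeg : ∀ c ∈ P, #{x ∈ R | c ∈ N x} + 2 * h c + 2 * s c = d)
    (hh : 2 * ∑ c ∈ P, h c + 3 ≤ d) :
    ∃ M₁ M₂ : X → C, Set.InjOn M₁ R ∧ Set.InjOn M₂ R ∧
      (∀ x ∈ R, M₁ x ∈ N x ∧ M₂ x ∈ N x ∧ M₁ x ≠ M₂ x) ∧
      (∀ c ∈ P, s c = 0 → (∃ x ∈ R, M₁ x = c) ∧ ∃ x ∈ R, M₂ x = c) ∧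
      ∀ c ∈ P, s c = 1 → (∃ x ∈ R, M₁ x = c) ∨ ∃ x ∈ R, M₂ x = c := by
  classical
  set ε : C → ℕ := fun c => min 2 (s c) with hε
  have hswap : ∀ (A : Finset X) (B : Finset C),
      ∑ c ∈ B, #{x ∈ A | c ∈ N x} = ∑ x ∈ A, #{c ∈ B | c ∈ N x} := fun A B =>
    (sum_card_bipartiteAbove_eq_sum_card_bipartiteBelow (s := A) (t := B) fun x c => c ∈ N x).symm
  have hNP : ∀ x ∈ R, {c ∈ P | c ∈ N x} = N x := fun x hx => by
    ext c
    simp only [mem_filter]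
    exact ⟨fun h => h.2, fun h => ⟨hN x hx h, h⟩⟩
  have hhc : ∀ c ∈ P, 2 * h c + 3 ≤ d := fun c hc => by
    have := single_le_sum (f := h) (fun _ _ => Nat.zero_le _) hc
    omega
  have ht : ∀ c ∈ P, 2 ≤ #{x ∈ R | c ∈ N x} + ε c := fun c hc => by
    have := hdeg c hc
    have := hhc c hc
    simp only [hε]
    omega
  have hs3 : d = 3 → ∑ c ∈ P, s c ≤ 2 := by
    intro hd
    have h1 := sum_congr rfl hdeg
    rw [sum_add_distrib, sum_add_distrib, ← mul_sum, ← mul_sum, hswap, sum_const, smul_eq_mul,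
      sum_congr rfl fun x hx => congrArg card (hNP x hx)] at h1
    have h2 := hdef R subset_rfl
    subst hd
    omega
  set I : Finset (C × (X ⊕ ℕ)) :=
    {p ∈ P ×ˢ R.disjSum (range 2) | Sum.elim (fun x => p.1 ∈ N x) (fun k => k < ε p.1) p.2} with hI
  set ν : C × (X ⊕ ℕ) → Option X := fun p => Sum.elim some (fun _ => none) p.2 with hν
  have hmemx : ∀ c x, (c, Sum.inl x) ∈ I ↔ c ∈ P ∧ x ∈ R ∧ c ∈ N x := by
    intro c x
    simp [hI, and_assoc]
  have hmemy : ∀ c k, (c, Sum.inr k) ∈ I ↔ c ∈ P ∧ k < ε c := by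
    intro c k
    have : ε c ≤ 2 := Nat.min_le_left _ _
    simp only [hI, mem_filter, mem_product, inr_mem_disjSum, mem_range, Sum.elim_inr]
    exact ⟨fun h => ⟨h.1.1, h.2⟩, fun h => ⟨⟨h.1, h.2.trans_le this⟩, h.2⟩⟩
  have hfib : ∀ c ∈ P, ∀ B : Finset (Option X), #{i ∈ I | i.1 = c ∧ ν i ∈ B} =
      #{x ∈ {x ∈ R | some x ∈ B} | c ∈ N x} + if none ∈ B then ε c else 0 := by
    intro c hc B
    have : {i ∈ I | i.1 = c ∧ ν i ∈ B} = ({x ∈ {x ∈ R | some x ∈ B} | c ∈ N x}.disjSum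
        (if none ∈ B then range (ε c) else ∅)).map ⟨fun z => (c, z), Prod.mk_right_injective c⟩ := by
      ext ⟨c', x | k⟩
      · simp only [mem_filter, hmemx, mem_map, Function.Embedding.coeFn_mk, Prod.mk.injEq, hν,
          Sum.elim_inl, exists_eq_right_right, inl_mem_disjSum]
        grind
      · simp only [mem_filter, hmemy, mem_map, Function.Embedding.coeFn_mk, Prod.mk.injEq, hν,
          Sum.elim_inr, exists_eq_right_right, inr_mem_disjSum]
        split_ifs <;> simp <;> grind
    rw [this, card_map, card_disjSum]
    split_ifs <;> simp
  set r : Option X → ℕ := fun o => o.elim (2 * (d - 2)) fun _ => 2 with hr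
  have hall : ∀ (A : Finset C) (B : Finset (Option X)), A ⊆ I.image Prod.fst → B ⊆ I.image ν →
      #{i ∈ I | i.1 ∈ A ∧ ν i ∈ B} ≤
        ∑ c ∈ A, (#{x ∈ R | c ∈ N x} + ε c - 2) + ∑ k ∈ B, r k := by
    intro A B hA _
    have hAP : A ⊆ P := by
      intro c hc
      obtain ⟨⟨c, z⟩, hi, rfl⟩ := mem_image.1 (hA hc)
      exact (mem_product.1 (mem_filter.1 hi).1).1
    set X₀ := {x ∈ R | some x ∈ B} with hX₀
    have hX₀R : X₀ ⊆ R := filter_subset _ _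
    have h1 : #{i ∈ I | i.1 ∈ A ∧ ν i ∈ B} =
        ∑ c ∈ A, (#{x ∈ X₀ | c ∈ N x} + if none ∈ B then ε c else 0) := by
      rw [card_eq_sum_card_fiberwise (f := Prod.fst) (t := A)
        fun i hi => (mem_filter.1 hi).2.1]
      refine sum_congr rfl fun c hc => ?_
      rw [← hfib c (hAP hc) B, filter_filter]
      refine congrArg _ (filter_congr fun i _ => ?_)
      exact ⟨fun h => ⟨h.2, h.1.2⟩, fun h => ⟨⟨h.1 ▸ hc, h.2⟩, h.1⟩⟩
    have h2 : ∑ c ∈ A, (#{x ∈ R | c ∈ N x} + ε c - 2) + 2 * #A =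
        ∑ c ∈ A, #{x ∈ R | c ∈ N x} + ∑ c ∈ A, ε c := by
      rw [mul_comm, ← smul_eq_mul, ← sum_const, ← sum_add_distrib, ← sum_add_distrib]
      exact sum_congr rfl fun c hc => Nat.sub_add_cancel (ht c (hAP hc))
    have hsplit : ∀ c, #{x ∈ R | c ∈ N x} = #{x ∈ X₀ | c ∈ N x} + #{x ∈ R \ X₀ | c ∈ N x} := by
      intro c
      rw [← card_union_of_disjoint (disjoint_filter_filter disjoint_sdiff), ← filter_union,
        union_sdiff_of_subset hX₀R]
    have h3 : ∀ D : Finset C, ∑ c ∈ D, #{x ∈ R | c ∈ N x} =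
        ∑ c ∈ D, #{x ∈ X₀ | c ∈ N x} + ∑ c ∈ D, #{x ∈ R \ X₀ | c ∈ N x} := fun D => by
      rw [← sum_add_distrib]
      exact sum_congr rfl fun c _ => hsplit c
    have h4 : 2 * #X₀ ≤ ∑ k ∈ B.erase none, r k := by
      calc 2 * #X₀ = ∑ k ∈ X₀.map Function.Embedding.some, r k := by
            rw [sum_map]
            simp [hr, mul_comm]
        _ ≤ _ := by
            refine sum_le_sum_of_subset fun k hk => ?_
            obtain ⟨x, hx, rfl⟩ := mem_map.1 hk
            exact mem_erase.2 ⟨by simp, (mem_filter.1 hx).2⟩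
    by_cases hB : none ∈ B
    · have h5 := add_sum_erase B r hB
      have h6 : r none = 2 * (d - 2) := rfl
      have h7 := hdef (R \ X₀) sdiff_subset
      have h8 : ∑ x ∈ R \ X₀, #(N x) ≤ ∑ c ∈ A, #{x ∈ R \ X₀ | c ∈ N x} + d * #(P \ A) := by
        rw [← sum_congr rfl fun x hx => congrArg card (hNP x (mem_sdiff.1 hx).1), ← hswap,
          ← sum_sdiff hAP, add_comm, mul_comm, ← smul_eq_mul, ← sum_const]
        refine Nat.add_le_add_left (sum_le_sum fun c hc => ?_) _
        have := hdeg c (mem_sdiff.1 hc).1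
        have := hsplit c
        omega
      have h9 := two_mul_add_le_of_deficiency (by omega)
        (h7.trans (Nat.add_le_add_right h8 d))
      have h10 := card_sdiff_add_card_eq_card hAP
      have h11 := card_sdiff_add_card_eq_card hX₀R
      simp only [hB, if_true, sum_add_distrib] at h1
      have h12 := h3 A
      omega
    · rw [erase_eq_of_notMem hB] at h4
      simp only [hB, if_false, add_zero] at h1
      have h5 := h3 A
      set D := {c ∈ A | s c ≤ 1} with hD
      have hDA : D ⊆ A := filter_subset _ _
      have h6 : ∑ c ∈ D, #{x ∈ R \ X₀ | c ∈ N x} ≤ ∑ c ∈ A, #{x ∈ R \ X₀ | c ∈ N x} :=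
        sum_le_sum_of_subset hDA
      have h7 : 2 * #A ≤ ∑ c ∈ A, ε c + (2 * #D - ∑ c ∈ D, s c) := by
        have e1 : ∑ c ∈ A \ D, ε c = 2 * #(A \ D) := by
          rw [mul_comm, ← smul_eq_mul, ← sum_const]
          refine sum_congr rfl fun c hc => ?_
          simp only [hD, mem_sdiff, mem_filter, not_and] at hc
          have := hc.2 hc.1
          simp only [hε]
          omega
        have e2 : ∑ c ∈ D, ε c = ∑ c ∈ D, s c := sum_congr rfl fun c hc => by
          have := (mem_filter.1 hc).2
          simp only [hε]
          omega
        have e3 := sum_sdiff (f := ε) hDA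
        have e4 := card_sdiff_add_card_eq_card hDA
        omega
      have h8 : ∑ c ∈ D, #{x ∈ R \ X₀ | c ∈ N x} + ∑ c ∈ D, #{x ∈ X₀ | c ∈ N x} +
          2 * ∑ c ∈ D, h c + 2 * ∑ c ∈ D, s c = d * #D := by
        have e1 : ∑ _c ∈ D, d = d * #D := by rw [sum_const, smul_eq_mul, mul_comm]
        rw [← e1, mul_sum, mul_sum, ← sum_add_distrib,
          ← sum_add_distrib, ← sum_add_distrib]
        refine sum_congr rfl fun c hc => ?_
        have := hdeg c (hAP (hDA hc))
        have := hsplit c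
        omega
      have h9 : ∑ c ∈ D, #{x ∈ X₀ | c ∈ N x} ≤ d * #X₀ := by
        rw [hswap, mul_comm, ← smul_eq_mul, ← sum_const]
        refine sum_le_sum fun x hx => (card_le_card ?_).trans (hdR x (hX₀R hx))
        intro c hc
        exact (mem_filter.1 hc).2
      have h10 : ∑ c ∈ D, h c ≤ ∑ c ∈ P, h c := sum_le_sum_of_subset (hDA.trans hAP)
      have h11 : ∑ c ∈ D, s c ≤ ∑ c ∈ P, s c := sum_le_sum_of_subset (hDA.trans hAP)
      have h12 := two_mul_le_of_slack h8 h9 (by omega) (fun hd => by have := hs3 hd; omega)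
      omega
  obtain ⟨J, hJI, hJ1, hJ2⟩ := exists_subset_card_fiber_le I Prod.fst ν
    (fun c => #{x ∈ R | c ∈ N x} + ε c - 2) r hall
  have hJc : ∀ c ∈ P, 2 ≤ #{i ∈ J | i.1 = c} := by
    intro c hc
    have h1 : #{i ∈ I | i.1 = c} = #{x ∈ R | c ∈ N x} + ε c := by
      have h1 := hfib c hc (insert none (R.map Function.Embedding.some))
      rw [if_pos (mem_insert_self _ _)] at h1
      rw [show {i ∈ I | i.1 = c} = {i ∈ I | i.1 = c ∧ ν i ∈
        insert none (R.map Function.Embedding.some)} from ?_, h1]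
      · congr 2
        ext x
        simp
      · refine filter_congr ?_
        rintro ⟨c', x | k⟩ hi
        · simp [hν, ((hmemx _ _).1 hi).2.1]
        · simp [hν]
    have h2 := hJ1 c
    have h3 := ht c hc
    have h4 : #{i ∈ I | i.1 = c} = #{i ∈ I \ J | i.1 = c} + #{i ∈ J | i.1 = c} := by
      rw [← card_union_of_disjoint (disjoint_filter_filter sdiff_disjoint), ← filter_union,
        sdiff_union_of_subset hJI]
    omega
  have hJsum : #J = ∑ c ∈ P, #{i ∈ J | i.1 = c} :=
    card_eq_sum_card_fiberwise fun i hi => (mem_product.1 (mem_filter.1 (hJI hi)).1).1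
  have hJsum' : #J = #{i ∈ J | ν i = none} + ∑ x ∈ R, #{i ∈ J | ν i = some x} := by
    rw [card_eq_sum_card_fiberwise (f := ν) (t := insert none (R.map Function.Embedding.some))]
    · rw [sum_insert (by simp), sum_map]
      rfl
    · rintro ⟨c', x | k⟩ hi
      · simp [hν, ((hmemx _ _).1 (hJI hi)).2.1]
      · simp [hν]
  have hJnone : #{i ∈ J | ν i = none} ≤ 2 * (d - 2) := hJ2 none
  have hJsome : ∀ x ∈ R, #{i ∈ J | ν i = some x} ≤ 2 := fun x _ => hJ2 (some x)
  have hPle : ∑ c ∈ P, 2 ≤ ∑ c ∈ P, #{i ∈ J | i.1 = c} := sum_le_sum hJc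
  have hRle : ∑ x ∈ R, #{i ∈ J | ν i = some x} ≤ ∑ x ∈ R, 2 := sum_le_sum hJsome
  have hPc : ∑ _c ∈ P, 2 = 2 * #P := by rw [sum_const, smul_eq_mul, mul_comm]
  have hRc : ∑ _x ∈ R, 2 = 2 * #R := by rw [sum_const, smul_eq_mul, mul_comm]
  have hJc2 : ∀ c ∈ P, 2 = #{i ∈ J | i.1 = c} :=
    (sum_eq_sum_iff_of_le hJc).1 (by omega)
  have hJx2 : ∀ x ∈ R, #{i ∈ J | ν i = some x} = 2 :=
    (sum_eq_sum_iff_of_le hJsome).1 (by omega)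
  have hN'x : ∀ x ∈ R, #{c ∈ P | (c, Sum.inl x) ∈ J} = 2 := by
    intro x hx
    rw [← hJx2 x hx]
    refine card_bij (fun c _ => (c, Sum.inl x)) ?_ ?_ ?_
    · intro c hc
      exact mem_filter.2 ⟨(mem_filter.1 hc).2, rfl⟩
    · intro c _ c' _ hcc
      exact (Prod.mk.injEq .. ▸ hcc).1
    · rintro ⟨c, y | k⟩ hi
      · rw [mem_filter] at hi
        have : y = x := by simpa [hν] using hi.2
        subst this
        exact ⟨c, mem_filter.2 ⟨((hmemx _ _).1 (hJI hi.1)).1, hi.1⟩, rfl⟩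
      · simp [hν] at hi
  have hN'c : ∀ c ∈ P, #{x ∈ R | c ∈ ({c ∈ P | (c, Sum.inl x) ∈ J} : Finset C)} ≤ 2 ∧
      2 ≤ #{x ∈ R | c ∈ ({c ∈ P | (c, Sum.inl x) ∈ J} : Finset C)} + ε c := by
    intro c hc
    have h1 : {i ∈ J | i.1 = c} = ({x ∈ R | c ∈ ({c ∈ P | (c, Sum.inl x) ∈ J} : Finset C)}.disjSum
        {k ∈ range (ε c) | (c, Sum.inr k) ∈ J}).map
          ⟨fun z => (c, z), Prod.mk_right_injective c⟩ := by
      ext ⟨c', x | k⟩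
      · simp only [mem_filter, mem_map, Function.Embedding.coeFn_mk, Prod.mk.injEq,
          exists_eq_right_right, inl_mem_disjSum]
        constructor
        · rintro ⟨h1, rfl⟩
          exact ⟨⟨((hmemx _ _).1 (hJI h1)).2.1, hc, h1⟩, rfl⟩
        · rintro ⟨⟨h1, h2, h3⟩, rfl⟩
          exact ⟨h3, rfl⟩
      · simp only [mem_filter, mem_map, Function.Embedding.coeFn_mk, Prod.mk.injEq,
          exists_eq_right_right, inr_mem_disjSum]
        constructor
        · rintro ⟨h1, rfl⟩
          exact ⟨⟨mem_range.2 ((hmemy _ _).1 (hJI h1)).2, h1⟩, rfl⟩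
        · rintro ⟨⟨h1, h2⟩, rfl⟩
          exact ⟨h2, rfl⟩
    have h2 := hJc2 c hc
    rw [h1, card_map, card_disjSum] at h2
    have h3 := (card_filter_le (range (ε c)) fun k => (c, Sum.inr k) ∈ J).trans (card_range _).le
    omega
  obtain ⟨M₁, M₂, h1, h2, h3, h4, h5⟩ := exists_two_matchings R P
    (fun x => {c ∈ P | (c, Sum.inl x) ∈ J}) (fun x _ => filter_subset _ _) hN'x
    (fun c hc => (hN'c c hc).1)
  have hJN : ∀ x ∈ R, ∀ c ∈ ({c ∈ P | (c, Sum.inl x) ∈ J} : Finset C), c ∈ N x :=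
    fun x _ c hc => ((hmemx _ _).1 (hJI (mem_filter.1 hc).2)).2.2
  refine ⟨M₁, M₂, h1, h2, fun x hx => ⟨hJN x hx _ (h3 x hx).1, hJN x hx _ (h3 x hx).2.1,
    (h3 x hx).2.2⟩, fun c hc hs => h4 c hc ?_, fun c hc hs => h5 c hc ?_⟩
  · have := hN'c c hc
    simp only [hε] at this
    omega
  · have := hN'c c hc
    simp only [hε] at this
    omega

end TwoFactor

section Extension

open Finset

variable {α : Type*} [DecidableEq V] [DecidableEq α] [Nonempty α]
  {χ : Sym2 V → α} {R U : Finset V} {P : Finset α}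

/-- An extension theorem in which a set of disjoint edges, given by `nb` on `S`, outside the
coloured part has prescribed colours. -/
theorem ProperOn.exists_extension_pairs (hU : #U = #P) (hodd : #P % 2 = 1) (nb : V → V) (κ : V → α)
    (k : ℕ) : ∀ (R S : Finset V) (χ : Sym2 V → α), R ⊆ U → ProperOn χ R P → #S = k →
      S ⊆ U \ R → (∀ u ∈ S, nb u ∈ U \ R ∧ nb u ∉ S ∧ κ u ∈ P) → Set.InjOn nb S →
      (∀ c ∈ P, #(missing χ R c) + 2 * #{u ∈ S | κ u = c} + #R ≤ #P + 1) →
      ∃ χ' : Sym2 V → α, ProperOn χ' U P ∧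
        (∀ x ∈ R, ∀ y ∈ R, x ≠ y → χ' s(x, y) = χ s(x, y)) ∧
        ∀ u ∈ S, χ' s(u, nb u) = κ u := by
  induction k with
  | zero =>
    intro R S χ hRU hχ hS _ _ _ hmiss
    obtain rfl := card_eq_zero.1 hS
    obtain ⟨χ', h1, h2⟩ := ProperOn.exists_extension hU hodd _ R χ hRU rfl hχ
      (fun c hc => by simpa using hmiss c hc)
    exact ⟨χ', h1, h2, by simp⟩
  | succ k ih =>
    intro R S χ hRU hχ hS hSU hnb hinj hmiss
    obtain ⟨u, hu⟩ : S.Nonempty := card_pos.1 (by omega)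
    obtain ⟨huU, huR⟩ := mem_sdiff.1 (hSU hu)
    obtain ⟨hv, hvS, hc₀⟩ := hnb u hu
    obtain ⟨hvU, hvR⟩ := mem_sdiff.1 hv
    have huv : u ≠ nb u := fun h => hvS (h ▸ hu)
    have hpar := hχ.card_missing_mod_two
    have hfree : ∀ x ∈ R, #(freeColors χ R P x) + #R = #P + 1 := fun x hx =>
      hχ.card_freeColors hx
    have hSc : 2 * #S + #R ≤ #P := by
      have h1 : Disjoint S (S.image nb) := by
        rw [Finset.disjoint_left]
        intro x hx hx'
        obtain ⟨y, hy, rfl⟩ := mem_image.1 hx'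
        exact (hnb y hy).2.1 hx
      have h2 : S ∪ S.image nb ⊆ U \ R := union_subset hSU (by
        intro x hx
        obtain ⟨y, hy, rfl⟩ := mem_image.1 hx
        exact (hnb y hy).1)
      have h3 := card_le_card h2
      rw [card_union_of_disjoint h1, card_image_of_injOn hinj] at h3
      have h4 := card_sdiff_add_card_eq_card hRU
      omega
    have hu₀ : 1 ≤ #{u' ∈ S | κ u' = κ u} := card_pos.2 ⟨u, mem_filter.2 ⟨hu, rfl⟩⟩
    have hN : ∀ c ∈ P.erase (κ u),
        {x ∈ R | c ∈ (freeColors χ R P x).erase (κ u)} = missing χ R c := by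
      intro c hc
      rw [mem_erase] at hc
      rw [missing_eq_filter hc.2]
      exact filter_congr fun x _ => by simp [hc.1]
    obtain ⟨M₁, M₂, hM₁, hM₂, hM, hs0, hs1⟩ := exists_two_matchings_of_slack R (P.erase (κ u))
      (fun x => (freeColors χ R P x).erase (κ u))
      (fun x _ => erase_subset_erase _ freeColors_subset) (#P + 1 - #R)
      (fun c => #{u' ∈ S | κ u' = c})
      (fun c => (#P + 1 - #R - #(missing χ R c) - 2 * #{u' ∈ S | κ u' = c}) / 2)
      (by rw [card_erase_of_mem hc₀]; omega)
      (fun x hx => by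
        have := card_erase_le (s := freeColors χ R P x) (a := κ u)
        have := hfree x hx
        omega)
      (fun A hA => by
        have h1 : (#P + 1 - #R) * #A ≤
            ∑ x ∈ A, #((freeColors χ R P x).erase (κ u)) + #(missing χ R (κ u)) := by
          calc (#P + 1 - #R) * #A = ∑ x ∈ A, #(freeColors χ R P x) := by
                rw [mul_comm, ← smul_eq_mul, ← sum_const]
                refine sum_congr rfl fun x hx => ?_
                have := hfree x (hA hx)
                omega
            _ ≤ ∑ x ∈ A, (#((freeColors χ R P x).erase (κ u)) +
                  if κ u ∈ freeColors χ R P x then 1 else 0) := by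
                refine sum_le_sum fun x _ => ?_
                split_ifs with h
                · exact (card_erase_add_one h).ge
                · rw [erase_eq_of_notMem h, add_zero]
            _ = ∑ x ∈ A, #((freeColors χ R P x).erase (κ u)) +
                  #{x ∈ A | κ u ∈ freeColors χ R P x} := by
                rw [sum_add_distrib, card_filter]
            _ ≤ _ := by
                rw [missing_eq_filter hc₀]
                exact Nat.add_le_add_left (card_le_card (filter_subset_filter _ hA)) _
        have h2 := hmiss (κ u) hc₀
        omega)
      (fun c hc => by
        rw [hN c hc]
        have := hpar c
        have := hmiss c (mem_of_mem_erase hc)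
        omega)
      (by
        have h1 : #S = ∑ c ∈ P, #{u' ∈ S | κ u' = c} :=
          card_eq_sum_card_fiberwise fun u' hu' => (hnb u' hu').2.2
        rw [← add_sum_erase _ _ hc₀] at h1
        omega)
    have hM₁f : ∀ x ∈ R, M₁ x ∈ freeColors χ R P x := fun x hx => mem_of_mem_erase (hM x hx).1
    have hM₂f : ∀ x ∈ R, M₂ x ∈ freeColors χ R P x := fun x hx => mem_of_mem_erase (hM x hx).2.1
    have hM₁c : ∀ x ∈ R, M₁ x ≠ κ u := fun x hx => ne_of_mem_erase (hM x hx).1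
    have hM₂c : ∀ x ∈ R, M₂ x ≠ κ u := fun x hx => ne_of_mem_erase (hM x hx).2.1
    have hRu : ∀ x ∈ R, x ≠ u := fun x hx => ne_of_mem_of_not_mem hx huR
    have hRv : ∀ x ∈ R, x ≠ nb u := fun x hx => ne_of_mem_of_not_mem hx hvR
    set χ₁ := addVertex χ u M₁ with hχ₁
    set M' : V → α := Function.update M₂ u (κ u) with hM'
    have hM'u : M' u = κ u := Function.update_self _ _ _
    have hM'R : ∀ x ∈ R, M' x = M₂ x := fun x hx => Function.update_of_ne (hRu x hx) _ _
    have hv₁ : nb u ∉ insert u R := by simp [huv.symm, hvR]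
    have hχ₁P : ProperOn χ₁ (insert u R) P := hχ.proper_addVertex huR hM₁ hM₁f
    have hM'i : Set.InjOn M' ↑(insert u R) := by
      intro x hx y hy hxy
      rcases mem_insert.1 hx with rfl | hx' <;> rcases mem_insert.1 hy with rfl | hy'
      · rfl
      · rw [hM'u, hM'R y hy'] at hxy
        exact absurd hxy.symm (hM₂c y hy')
      · rw [hM'u, hM'R x hx'] at hxy
        exact absurd hxy (hM₂c x hx')
      · rw [hM'R x hx', hM'R y hy'] at hxy
        exact hM₂ hx' hy' hxy
    have hM'f : ∀ x ∈ insert u R, M' x ∈ freeColors χ₁ (insert u R) P x := by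
      intro x hx
      rcases mem_insert.1 hx with rfl | hx'
      · rw [hM'u]
        exact (mem_freeColors_addVertex_self huR).2 ⟨hc₀, hM₁c⟩
      · rw [hM'R x hx']
        exact (mem_freeColors_addVertex huR hx').2 ⟨hM₂f x hx', (hM x hx').2.2⟩
    set χ₂ := addVertex χ₁ (nb u) M' with hχ₂
    have hmiss₂ : ∀ c ∈ P, #(missing χ₂ (insert (nb u) (insert u R)) c) +
        2 * #{u' ∈ S.erase u | κ u' = c} + #(insert (nb u) (insert u R)) ≤ #P + 1 := by
      intro c hc
      rw [card_insert_of_notMem hv₁, card_insert_of_notMem huR]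
      have h1 := hmiss c hc
      have ha : (∃ x ∈ R, M₁ x = c) → #(missing χ₁ (insert u R) c) + 1 = #(missing χ R c) :=
        card_missing_addVertex_of_mem hc huR hM₁ hM₁f
      have hb : (¬ ∃ x ∈ R, M₁ x = c) → #(missing χ₁ (insert u R) c) = #(missing χ R c) + 1 :=
        card_missing_addVertex_of_notMem hc huR
      have ha' : (∃ x ∈ insert u R, M' x = c) →
          #(missing χ₂ (insert (nb u) (insert u R)) c) + 1 = #(missing χ₁ (insert u R) c) :=
        card_missing_addVertex_of_mem hc hv₁ hM'i hM'f
      have hb' : (¬ ∃ x ∈ insert u R, M' x = c) →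
          #(missing χ₂ (insert (nb u) (insert u R)) c) = #(missing χ₁ (insert u R) c) + 1 :=
        card_missing_addVertex_of_notMem hc hv₁
      have hex : (∃ x ∈ R, M₂ x = c) → ∃ x ∈ insert u R, M' x = c := fun ⟨x, hx, hxc⟩ =>
        ⟨x, mem_insert_of_mem hx, (hM'R x hx).trans hxc⟩
      by_cases hcu : c = κ u
      · subst hcu
        have h2 : #{u' ∈ S.erase u | κ u' = κ u} + 1 = #{u' ∈ S | κ u' = κ u} := by
          rw [filter_erase]
          exact card_erase_add_one (mem_filter.2 ⟨hu, rfl⟩)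
        have h3 := hb (by push Not; exact hM₁c)
        have h4 := ha' ⟨u, mem_insert_self _ _, hM'u⟩
        omega
      · have h2 : #{u' ∈ S.erase u | κ u' = c} ≤ #{u' ∈ S | κ u' = c} :=
          card_le_card (filter_subset_filter _ (erase_subset _ _))
        have h3 := hs0 c (mem_erase.2 ⟨hcu, hc⟩)
        have h4 := hs1 c (mem_erase.2 ⟨hcu, hc⟩)
        have h5 := hpar c
        rcases Nat.lt_or_ge ((#P + 1 - #R - #(missing χ R c) - 2 * #{u' ∈ S | κ u' = c}) / 2) 1
          with h6 | h6
        · obtain ⟨h7, h8⟩ := h3 (by omega)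
          have h9 := ha h7
          have h10 := ha' (hex h8)
          omega
        · rcases Nat.lt_or_ge ((#P + 1 - #R - #(missing χ R c) - 2 * #{u' ∈ S | κ u' = c}) / 2) 2
            with h7 | h7
          · rcases h4 (by omega) with h8 | h8
            · have h9 := ha h8
              by_cases h10 : ∃ x ∈ insert u R, M' x = c
              · have := ha' h10
                omega
              · have := hb' h10
                omega
            · have h9 := ha' (hex h8)
              by_cases h10 : ∃ x ∈ R, M₁ x = c
              · have := ha h10
                omega
              · have := hb h10
                omega
          · have h9 : #(missing χ₁ (insert u R) c) ≤ #(missing χ R c) + 1 := by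
              by_cases h10 : ∃ x ∈ R, M₁ x = c
              · have := ha h10
                omega
              · exact (hb h10).le
            have h10 : #(missing χ₂ (insert (nb u) (insert u R)) c) ≤
                #(missing χ₁ (insert u R) c) + 1 := by
              by_cases h10 : ∃ x ∈ insert u R, M' x = c
              · have := ha' h10
                omega
              · exact (hb' h10).le
            omega
    obtain ⟨χ', h1, h2, h3⟩ := ih (insert (nb u) (insert u R)) (S.erase u) χ₂
      (insert_subset hvU (insert_subset huU hRU)) (hχ₁P.proper_addVertex hv₁ hM'i hM'f)
      (by rw [card_erase_of_mem hu]; omega)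
      (fun x hx => by
        rw [mem_erase] at hx
        have := mem_sdiff.1 (hSU hx.2)
        simp only [mem_sdiff, mem_insert, not_or]
        exact ⟨this.1, fun h => hvS (h ▸ hx.2), hx.1, this.2⟩)
      (fun x hx => by
        rw [mem_erase] at hx
        obtain ⟨h1, h2, h3⟩ := hnb x hx.2
        rw [mem_sdiff] at h1
        simp only [mem_sdiff, mem_insert, not_or, mem_erase, not_and]
        exact ⟨⟨h1.1, fun h => hx.1 (hinj hx.2 hu h), fun h => h2 (h ▸ hu), h1.2⟩,
          fun _ => h2, h3⟩)
      (hinj.mono (by simp)) hmiss₂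
    refine ⟨χ', h1, fun x hx y hy hxy => ?_, fun x hx => ?_⟩
    · rw [h2 x (by simp [hx]) y (by simp [hy]) hxy, hχ₂, addVertex_of_ne (hRv x hx) (hRv y hy),
        hχ₁, addVertex_of_ne (hRu x hx) (hRu y hy)]
    · by_cases hxu : x = u
      · subst hxu
        rw [h2 x (by simp) (nb x) (by simp) huv, hχ₂, addVertex_right huv, hM'u]
      · exact h3 x (mem_erase.2 ⟨hxu, hx⟩)

end Extension

section Extension

open Finset

variable {α : Type*} [DecidableEq V] [DecidableEq α] [Nonempty α]
  {χ : Sym2 V → α} {R U : Finset V} {P : Finset α}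

/-- An extension theorem with prescribed colours on the edges given by `nb`, which on `F` lead to
the coloured part and on `S` are disjoint edges outside the coloured part. -/
theorem ProperOn.exists_extension_prescribed (hU : #U = #P) (hodd : #P % 2 = 1) (nb : V → V)
    (κ : V → α) (S : Finset V) (hinj : Set.InjOn nb S) (k : ℕ) :
    ∀ (R F : Finset V) (χ : Sym2 V → α), R ⊆ U → ProperOn χ R P → #F = k →
      F ⊆ U \ R → S ⊆ U \ R → Disjoint F S →
      (∀ u ∈ S, nb u ∈ U \ R ∧ nb u ∉ S ∧ nb u ∉ F ∧ κ u ∈ P) →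
      (∀ w ∈ F, nb w ∈ R ∧ κ w ∈ freeColors χ R P (nb w)) →
      (∀ w ∈ F, ∀ w' ∈ F, w ≠ w' → nb w = nb w' → κ w ≠ κ w') →
      (∀ c ∈ P, #(missing χ R c) + #R ≤ #P + 1) →
      (∀ c ∈ P, 0 < #{u ∈ S | κ u = c} + #{w ∈ F | κ w = c} →
        #(missing χ R c) + 2 * #{u ∈ S | κ u = c} + 2 * #{w ∈ F | κ w ≠ c} + #R ≤ #P + 1) →
      ∃ χ' : Sym2 V → α, ProperOn χ' U P ∧
        (∀ x ∈ R, ∀ y ∈ R, x ≠ y → χ' s(x, y) = χ s(x, y)) ∧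
        (∀ u ∈ S, χ' s(u, nb u) = κ u) ∧ ∀ w ∈ F, χ' s(w, nb w) = κ w := by
  induction k with
  | zero =>
    intro R F χ hRU hχ hF _ hSU _ hnb _ _ hmiss hact
    obtain rfl := card_eq_zero.1 hF
    obtain ⟨χ', h1, h2, h3⟩ := ProperOn.exists_extension_pairs hU hodd nb κ _ R S χ hRU hχ rfl hSU
      (fun u hu => ⟨(hnb u hu).1, (hnb u hu).2.1, (hnb u hu).2.2.2⟩) hinj (fun c hc => by
        have h1 := hmiss c hc
        have h2 := hact c hc
        simp only [filter_empty, card_empty] at h2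
        omega)
    exact ⟨χ', h1, h2, h3, by simp⟩
  | succ k ih =>
    intro R F χ hRU hχ hF hFU hSU hFS hnb hnbF hne hmiss hact
    obtain ⟨w, hw⟩ : F.Nonempty := card_pos.1 (by omega)
    obtain ⟨hwU, hwR⟩ := mem_sdiff.1 (hFU hw)
    obtain ⟨hxR, hcf⟩ := hnbF w hw
    have hc₀ : κ w ∈ P := freeColors_subset hcf
    have hpar := hχ.card_missing_mod_two
    have hfree : ∀ x ∈ R, #(freeColors χ R P x) = #P + 1 - #R := fun x hx => by
      have := hχ.card_freeColors hx
      omega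
    have hRP : #R + 1 ≤ #P := by
      rw [← hU, ← card_insert_of_notMem hwR]
      exact card_le_card (insert_subset hwU hRU)
    have hf₀ : 1 ≤ #{w' ∈ F | κ w' = κ w} := card_pos.2 ⟨w, mem_filter.2 ⟨hw, rfl⟩⟩
    have hx₀ : nb w ∈ missing χ R (κ w) := by
      rw [missing_eq_filter hc₀]
      exact mem_filter.2 ⟨hxR, hcf⟩
    set N : V → Finset α := fun x =>
      {c ∈ freeColors χ R P x | c ≠ κ w ∧ ∀ w' ∈ F, nb w' = x → κ w' ≠ c} with hN
    obtain ⟨M₀, hM₀, hM₀N, hQ⟩ := exists_matching_of_degree (R.erase (nb w)) P N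
      (fun x _ => (filter_subset _ _).trans freeColors_subset)
      {c ∈ P | #(missing χ R c) = #P + 1 - #R ∧ #{u ∈ S | κ u = c} + #{w ∈ F | κ w = c} = 0}
      (filter_subset _ _) (#P + 1 - #R)
      (fun x hx => (card_le_card (filter_subset _ _)).trans (hfree x (mem_of_mem_erase hx)).le)
      (fun c hc => by
        have h1 : #{x ∈ R.erase (nb w) | c ∈ N x} ≤ #(missing χ R c) := by
          rw [missing_eq_filter hc]
          refine card_le_card fun x hx => ?_
          rw [mem_filter] at hx ⊢
          exact ⟨mem_of_mem_erase hx.1, (mem_filter.1 hx.2).1⟩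
        have h2 := hmiss c hc
        omega)
      (fun A hA => by
        have h1 : ∀ x ∈ A, #P + 1 - #R ≤ #(N x) + (if κ w ∈ freeColors χ R P x then 1 else 0) +
            #{w' ∈ {w' ∈ F | κ w' ≠ κ w} | nb w' = x} := by
          intro x hx
          rw [← hfree x (mem_of_mem_erase (hA hx))]
          have h2 : freeColors χ R P x ⊆ N x ∪ (if κ w ∈ freeColors χ R P x then {κ w} else ∅) ∪
              ({w' ∈ {w' ∈ F | κ w' ≠ κ w} | nb w' = x}).image κ := by
            intro c hc
            by_cases hcw : c = κ w
            · subst hcw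
              simp [hc]
            · by_cases h : ∀ w' ∈ F, nb w' = x → κ w' ≠ c
              · exact mem_union_left _ (mem_union_left _ (mem_filter.2 ⟨hc, hcw, h⟩))
              · push Not at h
                obtain ⟨w', hw', h1, rfl⟩ := h
                exact mem_union_right _ (mem_image_of_mem _ (by simp [hw', hcw, h1]))
          refine (card_le_card h2).trans ((card_union_le _ _).trans
            (Nat.add_le_add ((card_union_le _ _).trans (Nat.add_le_add_left ?_ _)) card_image_le))
          split_ifs <;> simp
        have h2 := sum_le_sum h1
        rw [sum_add_distrib, sum_add_distrib, sum_const, smul_eq_mul, mul_comm, ← card_filter,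
          sum_card_fiberwise_eq_card_filter] at h2
        have h3 : #{x ∈ A | κ w ∈ freeColors χ R P x} + 1 ≤ #(missing χ R (κ w)) := by
          rw [← card_erase_add_one hx₀, missing_eq_filter hc₀]
          refine Nat.add_le_add_right (card_le_card fun x hx => ?_) 1
          rw [mem_filter] at hx
          have := hA hx.1
          rw [mem_erase] at this
          exact mem_erase.2 ⟨this.1, mem_filter.2 ⟨this.2, hx.2⟩⟩
        have h4 := card_filter_le {w' ∈ F | κ w' ≠ κ w} fun w' => nb w' ∈ A
        have h5 := hact (κ w) hc₀ (by omega)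
        omega)
      (fun B hB => by
        have h1 : ∀ c ∈ B, #P + 1 - #R ≤ #{x ∈ R.erase (nb w) | c ∈ N x} +
            if c ∈ freeColors χ R P (nb w) then 1 else 0 := by
          intro c hc
          obtain ⟨hcP, h1, h2⟩ := mem_filter.1 (hB hc)
          have h3 : {w ∈ F | κ w = c} = ∅ := card_eq_zero.1 (by omega)
          rw [filter_eq_empty_iff] at h3
          have h4 : {x ∈ R.erase (nb w) | c ∈ N x} = (missing χ R c).erase (nb w) := by
            rw [missing_eq_filter hcP]
            ext x
            simp only [mem_filter, mem_erase, hN]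
            exact ⟨fun h => ⟨h.1.1, h.1.2, h.2.1⟩, fun h => ⟨⟨h.1, h.2.1⟩, h.2.2,
              fun h' => h3 hw h'.symm, fun w' hw' _ => h3 hw'⟩⟩
          rw [h4, ← h1]
          split_ifs with h5
          · exact (card_erase_add_one (by
              rw [missing_eq_filter hcP]
              exact mem_filter.2 ⟨hxR, h5⟩)).ge
          · rw [erase_eq_of_notMem (by
              rw [missing_eq_filter hcP]
              exact fun h => h5 (mem_filter.1 h).2), add_zero]
        have h2 := sum_le_sum h1
        rw [sum_add_distrib, sum_const, smul_eq_mul, mul_comm, ← card_filter] at h2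
        have h3 : #{c ∈ B | c ∈ freeColors χ R P (nb w)} ≤
            #((freeColors χ R P (nb w)).erase (κ w)) := by
          refine card_le_card fun c hc => ?_
          rw [mem_filter] at hc
          refine mem_erase.2 ⟨?_, hc.2⟩
          rintro rfl
          have := (mem_filter.1 (hB hc.1)).2.2
          omega
        have h4 := card_erase_add_one hcf
        have h5 := hfree _ hxR
        omega)
    have hRw : ∀ x ∈ R, x ≠ w := fun x hx => ne_of_mem_of_not_mem hx hwR
    set M : V → α := Function.update M₀ (nb w) (κ w) with hM
    have hMx : M (nb w) = κ w := Function.update_self _ _ _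
    have hMR : ∀ x ∈ R, x ≠ nb w → M x = M₀ x ∧ M x ∈ freeColors χ R P x ∧ M x ≠ κ w ∧
        ∀ w' ∈ F, nb w' = x → κ w' ≠ M x := fun x hx hxw => by
      have h1 : M x = M₀ x := Function.update_of_ne hxw _ _
      have h2 := mem_filter.1 (hM₀N x (mem_erase.2 ⟨hxw, hx⟩))
      rw [h1]
      exact ⟨rfl, h2⟩
    have hMi : Set.InjOn M R := by
      intro x hx y hy hxy
      by_cases hxw : x = nb w <;> by_cases hyw : y = nb w
      · rw [hxw, hyw]
      · rw [hxw, hMx] at hxy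
        exact absurd hxy.symm (hMR y hy hyw).2.2.1
      · rw [hyw, hMx] at hxy
        exact absurd hxy (hMR x hx hxw).2.2.1
      · rw [(hMR x hx hxw).1, (hMR y hy hyw).1] at hxy
        exact hM₀ (mem_erase.2 ⟨hxw, hx⟩) (mem_erase.2 ⟨hyw, hy⟩) hxy
    have hMf : ∀ x ∈ R, M x ∈ freeColors χ R P x := by
      intro x hx
      by_cases hxw : x = nb w
      · rw [hxw, hMx]
        exact hcf
      · exact (hMR x hx hxw).2.1
    have hle : ∀ c ∈ P, #(missing (addVertex χ w M) (insert w R) c) ≤ #(missing χ R c) + 1 := by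
      intro c hc
      by_cases h : ∃ x ∈ R, M x = c
      · have := card_missing_addVertex_of_mem hc hwR hMi hMf h
        omega
      · exact (card_missing_addVertex_of_notMem hc hwR h).le
    have hκ := card_missing_addVertex_of_mem hc₀ hwR hMi hMf ⟨_, hxR, hMx⟩
    have hfc : ∀ c, c ≠ κ w → #{w' ∈ F | κ w' ≠ c} = #{w' ∈ F.erase w | κ w' ≠ c} + 1 := by
      intro c hcw
      rw [filter_erase]
      exact (card_erase_add_one (mem_filter.2 ⟨hw, hcw.symm⟩)).symm
    obtain ⟨χ', h1, h2, h3, h4⟩ := ih (insert w R) (F.erase w) (addVertex χ w M)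
      (insert_subset hwU hRU) (hχ.proper_addVertex hwR hMi hMf)
      (by rw [card_erase_of_mem hw]; omega)
      (fun x hx => by
        rw [mem_erase] at hx
        have := mem_sdiff.1 (hFU hx.2)
        simp only [mem_sdiff, mem_insert, not_or]
        exact ⟨this.1, hx.1, this.2⟩)
      (fun x hx => by
        have := mem_sdiff.1 (hSU hx)
        simp only [mem_sdiff, mem_insert, not_or]
        exact ⟨this.1, fun h => Finset.disjoint_left.1 hFS hw (h ▸ hx), this.2⟩)
      (hFS.mono_left (erase_subset _ _))
      (fun u hu => by
        obtain ⟨h1, h2, h3, h4⟩ := hnb u hu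
        rw [mem_sdiff] at h1
        simp only [mem_sdiff, mem_insert, not_or, mem_erase, not_and]
        exact ⟨⟨h1.1, fun h => h3 (h ▸ hw), h1.2⟩, h2, fun _ => h3, h4⟩)
      (fun w' hw' => by
        rw [mem_erase] at hw'
        obtain ⟨h1, h2⟩ := hnbF w' hw'.2
        refine ⟨mem_insert_of_mem h1, (mem_freeColors_addVertex hwR h1).2 ⟨h2, ?_⟩⟩
        by_cases h3 : nb w' = nb w
        · rw [h3, hMx]
          exact hne w hw w' hw'.2 hw'.1.symm h3.symm
        · exact ((hMR _ h1 h3).2.2.2 w' hw'.2 rfl).symm)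
      (fun w₁ h₁ w₂ h₂ => hne w₁ (mem_of_mem_erase h₁) w₂ (mem_of_mem_erase h₂))
      (fun c hc => by
        rw [card_insert_of_notMem hwR]
        have h1 := hmiss c hc
        have h2 := hact c hc
        have h3 := hle c hc
        have h4 := hpar c
        by_cases hcw : c = κ w
        · subst hcw
          omega
        · have h5 := hfc c hcw
          by_cases h6 : #{u ∈ S | κ u = c} + #{w ∈ F | κ w = c} = 0
          · by_cases h7 : #(missing χ R c) = #P + 1 - #R
            · obtain ⟨x, hx, hxc⟩ := hQ c (mem_filter.2 ⟨hc, h7, h6⟩)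
              rw [mem_erase] at hx
              have := card_missing_addVertex_of_mem hc hwR hMi hMf
                ⟨x, hx.2, (hMR x hx.2 hx.1).1.trans hxc⟩
              omega
            · omega
          · have := h2 (by omega)
            omega)
      (fun c hc hpos => by
        rw [card_insert_of_notMem hwR]
        have h1 : #{w' ∈ F.erase w | κ w' = c} ≤ #{w' ∈ F | κ w' = c} :=
          card_le_card (filter_subset_filter _ (erase_subset _ _))
        have h2 := hact c hc (by omega)
        have h3 := hle c hc
        by_cases hcw : c = κ w
        · subst hcw
          have h4 : #{w' ∈ F.erase w | κ w' ≠ κ w} ≤ #{w' ∈ F | κ w' ≠ κ w} :=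
            card_le_card (filter_subset_filter _ (erase_subset _ _))
          omega
        · have h5 := hfc c hcw
          omega)
    refine ⟨χ', h1, fun x hx y hy hxy => ?_, h3, fun x hx => ?_⟩
    · rw [h2 x (by simp [hx]) y (by simp [hy]) hxy, addVertex_of_ne (hRw x hx) (hRw y hy)]
    · by_cases hxw : x = w
      · rw [hxw, h2 w (by simp) (nb w) (by simp [hxR]) (hRw _ hxR).symm, addVertex_left, hMx]
      · exact h4 x (mem_erase.2 ⟨hxw, hx⟩)

end Extension

section Edges

open Finset

variable {α : Type*} [DecidableEq V]
  {χ g : Sym2 V → α} {R : Finset V} {P Q : Finset α} {c : α} {x : V} {e : Sym2 V}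

/-- The edges of the complete graph on `R`. -/
def innerEdges (R : Finset V) : Finset (Sym2 V) := {e ∈ R.sym2 | ¬ e.IsDiag}

theorem mem_innerEdges : e ∈ innerEdges R ↔ (∀ x ∈ e, x ∈ R) ∧ ¬ e.IsDiag := by
  simp [innerEdges, mem_sym2_iff]

theorem mk_mem_innerEdges {y : V} : s(x, y) ∈ innerEdges R ↔ x ∈ R ∧ y ∈ R ∧ x ≠ y := by
  simp [innerEdges, and_assoc]

theorem exists_eq_mk_of_mem_innerEdges (he : e ∈ innerEdges R) (hx : x ∈ e) :
    ∃ y ∈ R, y ≠ x ∧ e = s(x, y) := by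
  obtain ⟨y, rfl⟩ := hx
  rw [mk_mem_innerEdges] at he
  exact ⟨y, he.2.1, he.2.2.symm, rfl⟩

theorem properOn_iff : ProperOn χ R P ↔ (∀ e ∈ innerEdges R, χ e ∈ P) ∧
    ∀ e ∈ innerEdges R, ∀ e' ∈ innerEdges R, e ≠ e' → ∀ x ∈ e, x ∈ e' → χ e ≠ χ e' := by
  constructor
  · refine fun h => ⟨fun e he => ?_, fun e he e' he' hne x hx hx' => ?_⟩
    · induction e with
      | h x y =>
        obtain ⟨h1, h2, h3⟩ := mk_mem_innerEdges.1 he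
        exact h.mem x h1 y h2 h3
    · obtain ⟨y, hy, hyx, rfl⟩ := exists_eq_mk_of_mem_innerEdges he hx
      obtain ⟨z, hz, hzx, rfl⟩ := exists_eq_mk_of_mem_innerEdges he' hx'
      exact h.ne x ((mem_innerEdges.1 he).1 x hx) y hy z hz hyx.symm hzx.symm
        fun hyz => hne (by rw [hyz])
  · refine fun h => ⟨fun x hx y hy hxy => h.1 _ (mk_mem_innerEdges.2 ⟨hx, hy, hxy⟩),
      fun x hx y hy z hz hxy hxz hyz => h.2 _ (mk_mem_innerEdges.2 ⟨hx, hy, hxy⟩) _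
        (mk_mem_innerEdges.2 ⟨hx, hz, hxz⟩) (fun he => hyz (Sym2.congr_right.1 he)) x
        (Sym2.mem_mk_left _ _) (Sym2.mem_mk_left _ _)⟩

variable [DecidableEq α]

theorem mem_missing_iff :
    x ∈ missing χ R c ↔ x ∈ R ∧ ∀ e ∈ innerEdges R, x ∈ e → χ e ≠ c := by
  rw [mem_missing]
  refine and_congr_right fun hx => ⟨fun h e he hxe => ?_, fun h y hy hyx =>
    h _ (mk_mem_innerEdges.2 ⟨hx, hy, hyx.symm⟩) (Sym2.mem_mk_left _ _)⟩
  obtain ⟨y, hy, hyx, rfl⟩ := exists_eq_mk_of_mem_innerEdges he hxe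
  exact h y hy hyx

theorem mem_freeColors_iff (hx : x ∈ R) :
    c ∈ freeColors χ R P x ↔ c ∈ P ∧ ∀ e ∈ innerEdges R, x ∈ e → χ e ≠ c := by
  have := mem_missing_iff (χ := χ) (R := R) (c := c) (x := x)
  rw [mem_missing] at this
  rw [mem_freeColors]
  tauto

theorem ProperOn.card_star_le_one (h : ProperOn g R Q) (x : V) (c : α) :
    #{e ∈ innerEdges R | x ∈ e ∧ g e = c} ≤ 1 := by
  rw [card_le_one]
  intro e he e' he'
  rw [mem_filter] at he he'
  by_contra hne
  exact (properOn_iff.1 h).2 e he.1 e' he'.1 hne x he.2.1 he'.2.1 (he.2.2.trans he'.2.2.symm)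

theorem card_toFinset_le_two (e : Sym2 V) : #e.toFinset ≤ 2 := by
  rw [Sym2.card_toFinset]
  split_ifs <;> omega

theorem card_biUnion_toFinset_le (e : Sym2 V) {β : Type*} [DecidableEq β] (f : V → Finset β)
    (hf : ∀ x, #(f x) ≤ 1) : #(e.toFinset.biUnion f) ≤ 2 := by
  have h1 := card_biUnion_le_card_mul e.toFinset f 1 fun x _ => hf x
  have h2 := card_toFinset_le_two e
  omega

theorem Finset.exists_injOn_of_card_le {β γ : Type*} [Nonempty γ] {s : Finset β} {t : Finset γ}
    (h : #s ≤ #t) : ∃ f : β → γ, (∀ x ∈ s, f x ∈ t) ∧ Set.InjOn f s := by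
  obtain ⟨f, hf, hi⟩ := s.finite_toSet.exists_injOn_of_encard_le (t := (t : Set γ)) (by
    simpa using h)
  exact ⟨f, fun x hx => hf hx, hi⟩

/-- Force prescribed colours on the edges `F₀`, and free prescribed colours at the vertices
`nb w`, by recolouring the conflicting edges with distinct colours outside `Q`. -/
theorem ProperOn.exists_recoloring [Nonempty α] (hg : ProperOn g R Q) (hQP : Q ⊆ P)
    {F₀ F₁ : Finset (Sym2 V)} {col : Sym2 V → α} (hF₀ : F₀ ⊆ innerEdges R)
    (hcol : ∀ e ∈ F₀, col e ∈ P)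
    (hne : ∀ e ∈ F₀, ∀ e' ∈ F₀, e ≠ e' → ∀ x ∈ e, x ∈ e' → col e ≠ col e')
    (h1 : ∀ e ∈ F₁, g e = col e) {F : Finset V} {nb : V → V} {κ : V → α}
    (hF : ∀ w ∈ F, nb w ∈ R ∧ κ w ∈ Q) (hFe : ∀ w ∈ F, ∀ e ∈ F₀, nb w ∈ e → col e ≠ κ w)
    (hb : 2 * #(F₀ \ F₁) + #F + #Q ≤ #P) :
    ∃ χ : Sym2 V → α, ProperOn χ R P ∧ (∀ e ∈ F₀, χ e = col e) ∧
      (∀ w ∈ F, κ w ∈ freeColors χ R P (nb w)) ∧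
      ∀ c ∈ Q, #(missing χ R c) ≤ #(missing g R c) + 2 * #(F₀ \ F₁) + 2 * #{w ∈ F | κ w = c} := by
  classical
  set E₁ := F₀ \ F₁ with hE₁
  set star : V → α → Finset (Sym2 V) := fun x c => {e ∈ innerEdges R | x ∈ e ∧ g e = c} with hstar
  have hstar1 : ∀ x c, #(star x c) ≤ 1 := hg.card_star_le_one
  have hmem_star : ∀ {x c e}, e ∈ star x c ↔ e ∈ innerEdges R ∧ x ∈ e ∧ g e = c := by
    simp [hstar]
  set B : Finset (Sym2 V) := {e' ∈ innerEdges R | e' ∉ F₀ ∧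
    ((∃ e ∈ E₁, ∃ x ∈ e, x ∈ e' ∧ g e' = col e) ∨ ∃ w ∈ F, nb w ∈ e' ∧ g e' = κ w)} with hB
  obtain ⟨hgQ, hgne⟩ := properOn_iff.1 hg
  have hBsub : B ⊆ {e ∈ E₁ | col e ∈ Q}.biUnion
      (fun e => e.toFinset.biUnion fun x => star x (col e)) ∪
        F.biUnion fun w => star (nb w) (κ w) := by
    intro e' he'
    obtain ⟨hi, -, ⟨e, he, x, hx, hx', hge⟩ | ⟨w, hw, hwe, hge⟩⟩ := mem_filter.1 he'
    · refine mem_union_left _ (mem_biUnion.2 ⟨e, mem_filter.2 ⟨he, hge ▸ hgQ e' hi⟩,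
        mem_biUnion.2 ⟨x, by simpa using hx, hmem_star.2 ⟨hi, hx', hge⟩⟩⟩)
    · exact mem_union_right _ (mem_biUnion.2 ⟨w, hw, hmem_star.2 ⟨hi, hwe, hge⟩⟩)
  have hBcard : #B ≤ 2 * #{e ∈ E₁ | col e ∈ Q} + #F := by
    refine (card_le_card hBsub).trans ((card_union_le _ _).trans (Nat.add_le_add ?_ ?_))
    · rw [mul_comm]
      exact card_biUnion_le_card_mul _ _ 2 fun e _ => card_biUnion_toFinset_le e _ fun x => hstar1 _ _
    · simpa using card_biUnion_le_card_mul F _ 1 fun w _ => hstar1 (nb w) (κ w)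
  have himg : #(E₁.image col \ Q) ≤ #{e ∈ E₁ | col e ∉ Q} := by
    refine le_trans (card_le_card ?_) (card_image_le (f := col))
    intro c hc
    obtain ⟨hc1, hcQ⟩ := mem_sdiff.1 hc
    obtain ⟨e, he, rfl⟩ := mem_image.1 hc1
    exact mem_image_of_mem _ (mem_filter.2 ⟨he, hcQ⟩)
  have hsplit := card_filter_add_card_filter_not (s := E₁) (fun e => col e ∈ Q)
  have hBP : #B ≤ #((P \ Q) \ (E₁.image col \ Q)) := by
    have h2 := le_card_sdiff (E₁.image col \ Q) (P \ Q)
    rw [card_sdiff_of_subset hQP] at h2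
    omega
  obtain ⟨fr, hfr, hinj⟩ := exists_injOn_of_card_le hBP
  have hfrP : ∀ e ∈ B, fr e ∈ P := fun e he => (mem_sdiff.1 (mem_sdiff.1 (hfr e he)).1).1
  have hfrQ : ∀ e ∈ B, fr e ∉ Q := fun e he => (mem_sdiff.1 (mem_sdiff.1 (hfr e he)).1).2
  have hfrE : ∀ e ∈ B, ∀ e' ∈ E₁, col e' ≠ fr e := fun e he e' he' heq =>
    (mem_sdiff.1 (hfr e he)).2 (mem_sdiff.2 ⟨heq ▸ mem_image_of_mem _ he', hfrQ e he⟩)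
  have hEF : ∀ e ∈ E₁, e ∈ F₀ := fun e he => (mem_sdiff.1 he).1
  have hFg : ∀ e ∈ F₀, e ∉ E₁ → g e = col e := fun e he hn => h1 e (by
    by_contra h
    exact hn (mem_sdiff.2 ⟨he, h⟩))
  have hBF : ∀ e ∈ B, e ∉ F₀ := fun e he => (mem_filter.1 he).2.1
  have hkeep : ∀ e ∈ E₁, ∀ e' ∈ innerEdges R, e' ∉ E₁ → e' ∉ B → ∀ x ∈ e, x ∈ e' →
      col e ≠ g e' := by
    intro e he e' hi' hE' hB' x hx hx' heq
    by_cases hF' : e' ∈ F₀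
    · exact hne e (hEF e he) e' hF' (fun h => hE' (h ▸ he)) x hx hx' (heq.trans (hFg e' hF' hE'))
    · exact hB' (mem_filter.2 ⟨hi', hF', Or.inl ⟨e, he, x, hx, hx', heq.symm⟩⟩)
  set χ : Sym2 V → α := fun e => if e ∈ E₁ then col e else if e ∈ B then fr e else g e with hχ
  have hχE : ∀ e ∈ E₁, χ e = col e := fun e he => if_pos he
  have hχB : ∀ e ∈ B, χ e = fr e := fun e he => by
    rw [hχ]
    dsimp only
    rw [if_neg fun h => hBF e he (hEF e h), if_pos he]
  have hχg : ∀ e, e ∉ E₁ → e ∉ B → χ e = g e := fun e he he' => by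
    rw [hχ]
    dsimp only
    rw [if_neg he, if_neg he']
  have hχF : ∀ e ∈ F₀, χ e = col e := fun e he => by
    by_cases hE : e ∈ E₁
    · exact hχE e hE
    · rw [hχg e hE fun hB' => hBF e hB' he, hFg e he hE]
  refine ⟨χ, properOn_iff.2 ⟨fun e he => ?_, fun e he e' he' hee x hx hx' heq => ?_⟩, hχF,
    fun w hw => ?_, fun c hc => ?_⟩
  · by_cases hE : e ∈ E₁
    · rw [hχE e hE]; exact hcol e (hEF e hE)
    by_cases hB' : e ∈ B
    · rw [hχB e hB']; exact hfrP e hB'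
    · rw [hχg e hE hB']; exact hQP (hgQ e he)
  · by_cases hE : e ∈ E₁ <;> by_cases hE' : e' ∈ E₁
    · rw [hχE e hE, hχE e' hE'] at heq
      exact hne e (hEF e hE) e' (hEF e' hE') hee x hx hx' heq
    · rw [hχE e hE] at heq
      by_cases hB' : e' ∈ B
      · rw [hχB e' hB'] at heq
        exact hfrE e' hB' e hE heq
      · rw [hχg e' hE' hB'] at heq
        exact hkeep e hE e' he' hE' hB' x hx hx' heq
    · rw [hχE e' hE'] at heq
      by_cases hB' : e ∈ B
      · rw [hχB e hB'] at heq
        exact hfrE e hB' e' hE' heq.symm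
      · rw [hχg e hE hB'] at heq
        exact hkeep e' hE' e he hE hB' x hx' hx heq.symm
    · by_cases hB : e ∈ B <;> by_cases hB' : e' ∈ B
      · rw [hχB e hB, hχB e' hB'] at heq
        exact hee (hinj hB hB' heq)
      · rw [hχB e hB, hχg e' hE' hB'] at heq
        exact hfrQ e hB (heq ▸ hgQ e' he')
      · rw [hχg e hE hB, hχB e' hB'] at heq
        exact hfrQ e' hB' (heq ▸ hgQ e he)
      · rw [hχg e hE hB, hχg e' hE' hB'] at heq
        exact hgne e he e' he' hee x hx hx' heq
  · obtain ⟨hwR, hκ⟩ := hF w hw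
    refine (mem_freeColors_iff hwR).2 ⟨hQP hκ, fun e he hwe heq => ?_⟩
    by_cases hF' : e ∈ F₀
    · exact hFe w hw e hF' hwe ((hχF e hF').symm.trans heq)
    by_cases hB' : e ∈ B
    · rw [hχB e hB'] at heq
      exact hfrQ e hB' (heq ▸ hκ)
    · rw [hχg e (fun h => hF' (hEF e h)) hB'] at heq
      exact hB' (mem_filter.2 ⟨he, hF', Or.inr ⟨w, hw, hwe, heq⟩⟩)
  · set X : Sym2 V → Finset V := fun e => if col e = c then
      e.toFinset.biUnion fun y => (star y c).biUnion fun e' => e'.toFinset.erase y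
      else e.toFinset with hX
    have hXcard : ∀ e, #(X e) ≤ 2 := by
      intro e
      rw [hX]
      dsimp only
      split_ifs with hec
      · refine card_biUnion_toFinset_le e _ fun y => ?_
        refine (card_biUnion_le_card_mul _ _ 1 fun e' he' => ?_).trans (by simpa using hstar1 y c)
        have hy : y ∈ e'.toFinset := by simpa using (hmem_star.1 he').2.1
        have := card_toFinset_le_two e'
        rw [card_erase_of_mem hy]
        omega
      · exact card_toFinset_le_two e
    have hsub : missing χ R c ⊆ (missing g R c ∪ E₁.biUnion X) ∪
        {w ∈ F | κ w = c}.biUnion fun w => (star (nb w) c).biUnion Sym2.toFinset := by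
      intro x hx
      obtain ⟨hxR, hxc⟩ := mem_missing_iff.1 hx
      by_cases hxg : x ∈ missing g R c
      · exact mem_union_left _ (mem_union_left _ hxg)
      rw [mem_missing_iff, not_and] at hxg
      have hxg' := hxg hxR
      push Not at hxg'
      obtain ⟨e', hi', hxe', hgc⟩ := hxg'
      have hxχ := hxc e' hi' hxe'
      by_cases hE' : e' ∈ E₁
      · refine mem_union_left _ (mem_union_right _ (mem_biUnion.2 ⟨e', hE', ?_⟩))
        rw [hX]
        dsimp only
        rw [if_neg fun h => hxχ ((hχE e' hE').trans h)]
        simpa using hxe'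
      by_cases hB' : e' ∈ B
      · obtain ⟨-, -, ⟨e, he, y, hy, hy', hge⟩ | ⟨w, hw, hwe, hge⟩⟩ := mem_filter.1 hB'
        · have hec : col e = c := hge.symm.trans hgc
          refine mem_union_left _ (mem_union_right _ (mem_biUnion.2 ⟨e, he, ?_⟩))
          rw [hX]
          dsimp only
          rw [if_pos hec]
          refine mem_biUnion.2 ⟨y, by simpa using hy, mem_biUnion.2 ⟨e', hmem_star.2 ⟨hi', hy', hgc⟩,
            mem_erase.2 ⟨?_, by simpa using hxe'⟩⟩⟩
          rintro rfl
          exact hxc e (hF₀ (hEF e he)) hy ((hχE e he).trans hec)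
        · exact mem_union_right _ (mem_biUnion.2 ⟨w, mem_filter.2 ⟨hw, hge.symm.trans hgc⟩,
            mem_biUnion.2 ⟨e', hmem_star.2 ⟨hi', hwe, hgc⟩, by simpa using hxe'⟩⟩)
      · exact absurd ((hχg e' hE' hB').trans hgc) hxχ
    have hX2 : #(E₁.biUnion X) ≤ #E₁ * 2 := card_biUnion_le_card_mul _ _ _ fun e _ => hXcard e
    have hY2 : #({w ∈ F | κ w = c}.biUnion fun w => (star (nb w) c).biUnion Sym2.toFinset) ≤
        #{w ∈ F | κ w = c} * 2 := card_biUnion_le_card_mul _ _ _ fun w _ => by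
      have h2 := card_biUnion_le_card_mul (star (nb w) c) Sym2.toFinset 2
        fun e _ => card_toFinset_le_two e
      have := hstar1 (nb w) c
      omega
    have h3 := (card_le_card hsub).trans (card_union_le _ _)
    have h4 := card_union_le (missing g R c) (E₁.biUnion X)
    omega

end Edges

section Stealing

open Finset

variable {α : Type*} [DecidableEq V] [DecidableEq α]
  {χ : Sym2 V → α} {R : Finset V} {P : Finset α}

theorem ProperOn.sum_card_missing (h : ProperOn χ R P) :
    ∑ c ∈ P, #(missing χ R c) + #R * #R = #R * (#P + 1) := by
  have h1 := sum_card_filter_mem_freeColors (χ := χ) (R := R) (P := P) R P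
  rw [sum_congr rfl fun c hc => congrArg _ (filter_mem_freeColors hc),
    sum_congr rfl fun x _ => congrArg _ (inter_eq_left.2 freeColors_subset)] at h1
  have h2 : ∑ x ∈ R, (#(freeColors χ R P x) + #R) = ∑ x ∈ R, (#P + 1) :=
    sum_congr rfl fun x hx => h.card_freeColors hx
  rw [sum_add_distrib, sum_const, sum_const, smul_eq_mul, smul_eq_mul] at h2
  rw [h1, h2]

/-- Recolour edges outside `F₀` until every colour is used, keeping each colour `c` of `A` on at
least `T c + 1` edges. -/
theorem ProperOn.exists_all_colors_used {A : Finset α} {T : α → ℕ} {F₀ : Finset (Sym2 V)}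
    (hF₀ : F₀ ⊆ innerEdges R) (hodd : #R % 2 = 1)
    (hnum : 2 * (#P - 1) + 2 * ∑ c ∈ P, T c + 2 * (#F₀ - 1) + #R < #R * #R) (k : ℕ) :
    ∀ χ : Sym2 V → α, ProperOn χ R P → #{c ∈ P | missing χ R c = R} = k →
      (∀ c ∈ A, #(missing χ R c) + 2 * T c + 2 ≤ #R) →
      ∃ χ' : Sym2 V → α, ProperOn χ' R P ∧ (∀ e ∈ F₀, χ' e = χ e) ∧
        (∀ c ∈ A, missing χ R c ⊆ missing χ' R c) ∧
        (∀ c ∈ A, #(missing χ' R c) + 2 * T c + 2 ≤ #R) ∧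
        ∀ c ∈ P, #(missing χ' R c) + 2 ≤ #R := by
  induction k using Nat.strong_induction_on with
  | _ k ih =>
  intro χ hχ hk hA
  have hpar := hχ.card_missing_mod_two
  have hle : ∀ c, #(missing χ R c) ≤ #R := fun c => card_le_card missing_subset
  rcases eq_empty_or_nonempty {c ∈ P | missing χ R c = R} with h0 | ⟨c₀, hc₀⟩
  · refine ⟨χ, hχ, fun _ _ => rfl, fun _ _ => Subset.rfl, hA, fun c hc => ?_⟩
    have h1 : #(missing χ R c) ≠ #R := fun h => by
      have : c ∈ ({c ∈ P | missing χ R c = R} : Finset α) :=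
        mem_filter.2 ⟨hc, eq_of_subset_of_card_le missing_subset h.ge⟩
      simp [h0] at this
    have := hpar c
    have := hle c
    omega
  obtain ⟨hc₀P, hc₀R⟩ := mem_filter.1 hc₀
  have hc₀A : c₀ ∉ A := fun h => by
    have := hA c₀ h
    rw [hc₀R] at this
    omega
  have hc₀χ : ∀ e ∈ innerEdges R, χ e ≠ c₀ := by
    intro e he
    induction e with
    | h x y =>
      have hx : x ∈ missing χ R c₀ := hc₀R.ge (mk_mem_innerEdges.1 he).1
      exact (mem_missing_iff.1 hx).2 _ he (Sym2.mem_mk_left _ _)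
  obtain ⟨e₁, he₁, he₁F, hroom⟩ : ∃ e ∈ innerEdges R, e ∉ F₀ ∧
      #(missing χ R (χ e)) + 2 + 2 * T (χ e) + 2 ≤ #R := by
    by_contra! hstuck
    obtain ⟨F', hF', hFcard⟩ : ∃ F' : Finset (Sym2 V), #F' = #F₀ - 1 ∧
        ∀ c, #{e ∈ F₀ | χ e = c} ≤ #{e ∈ F' | χ e = c} + 1 := by
      rcases F₀.eq_empty_or_nonempty with rfl | ⟨e₀, he₀⟩
      · exact ⟨∅, by simp⟩
      · refine ⟨F₀.erase e₀, card_erase_of_mem he₀, fun c => ?_⟩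
        rw [filter_erase]
        have := pred_card_le_card_erase (s := {e ∈ F₀ | χ e = c}) (a := e₀)
        omega
    have hbound : ∀ c ∈ P.erase c₀,
        #R ≤ #(missing χ R c) + (2 + 2 * T c + 2 * #{e ∈ F' | χ e = c}) := by
      intro c _
      by_cases hex : ∃ e ∈ innerEdges R, e ∉ F₀ ∧ χ e = c
      · obtain ⟨e, he, heF, rfl⟩ := hex
        have := hstuck e he heF
        have := hpar (χ e)
        omega
      · push Not at hex
        have hsub : R \ missing χ R c ⊆ {e ∈ F₀ | χ e = c}.biUnion Sym2.toFinset := by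
          intro x hx
          rw [mem_sdiff, mem_missing_iff, not_and] at hx
          have hx' := hx.2 hx.1
          push Not at hx'
          obtain ⟨e, he, hxe, hec⟩ := hx'
          refine mem_biUnion.2 ⟨e, mem_filter.2 ⟨?_, hec⟩, by simpa using hxe⟩
          by_contra heF
          exact hex e he heF hec
        have h1 := (card_le_card hsub).trans
          (card_biUnion_le_card_mul _ _ 2 fun e _ => card_toFinset_le_two e)
        rw [card_sdiff_of_subset missing_subset] at h1
        have := hFcard c
        omega
    have hsum := sum_le_sum hbound
    rw [sum_add_distrib, sum_add_distrib, sum_add_distrib, sum_const, sum_const,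
      card_erase_of_mem hc₀P, smul_eq_mul, smul_eq_mul, ← mul_sum, ← mul_sum] at hsum
    have hm := hχ.sum_card_missing
    rw [← add_sum_erase _ _ hc₀P, hc₀R] at hm
    have hTs : ∑ c ∈ P.erase c₀, T c ≤ ∑ c ∈ P, T c :=
      sum_le_sum_of_subset (erase_subset _ _)
    have hFs : ∑ c ∈ P.erase c₀, #{e ∈ F' | χ e = c} ≤ #F' := by
      rw [sum_card_fiberwise_eq_card_filter]
      exact card_filter_le _ _
    have hP : 0 < #P := card_pos.2 ⟨c₀, hc₀P⟩
    obtain ⟨q, hq⟩ : ∃ q, #P = q + 1 := ⟨#P - 1, by omega⟩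
    rw [hq] at hm hsum hnum
    simp only [Nat.add_sub_cancel] at hsum hnum
    nlinarith
  have hc₁ : χ e₁ ≠ c₀ := hc₀χ e₁ he₁
  set χ' := Function.update χ e₁ c₀ with hχ'
  have hχ'₁ : χ' e₁ = c₀ := Function.update_self _ _ _
  have hχ'ne : ∀ e, e ≠ e₁ → χ' e = χ e := fun e he => Function.update_of_ne he _ _
  obtain ⟨hmem, hne⟩ := properOn_iff.1 hχ
  have hproper : ProperOn χ' R P := by
    refine properOn_iff.2 ⟨fun e he => ?_, fun e he e' he' hee x hx hx' => ?_⟩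
    · by_cases h : e = e₁
      · rw [h, hχ'₁]; exact hc₀P
      · rw [hχ'ne e h]; exact hmem e he
    · by_cases h : e = e₁
      · subst h
        rw [hχ'₁, hχ'ne e' hee.symm]
        exact (hc₀χ e' he').symm
      · rw [hχ'ne e h]
        by_cases h' : e' = e₁
        · subst h'
          rw [hχ'₁]
          exact hc₀χ e he
        · rw [hχ'ne e' h']
          exact hne e he e' he' hee x hx hx'
  have hmono : ∀ c, c ≠ c₀ → missing χ R c ⊆ missing χ' R c := by
    intro c hc x hx
    rw [mem_missing_iff] at hx ⊢
    refine ⟨hx.1, fun e he hxe => ?_⟩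
    by_cases h : e = e₁
    · rw [h, hχ'₁]; exact hc.symm
    · rw [hχ'ne e h]; exact hx.2 e he hxe
  have hsame : ∀ c, c ≠ χ e₁ → missing χ' R c ⊆ missing χ R c := by
    intro c hc x hx
    rw [mem_missing_iff] at hx ⊢
    refine ⟨hx.1, fun e he hxe => ?_⟩
    by_cases h : e = e₁
    · rw [h]; exact hc.symm
    · rw [← hχ'ne e h]; exact hx.2 e he hxe
  have hgrow : #(missing χ' R (χ e₁)) ≤ #(missing χ R (χ e₁)) + 2 := by
    have hsub : missing χ' R (χ e₁) ⊆ missing χ R (χ e₁) ∪ e₁.toFinset := by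
      intro x hx
      by_cases hxe : x ∈ e₁
      · exact mem_union_right _ (by simpa using hxe)
      rw [mem_missing_iff] at hx
      refine mem_union_left _ (mem_missing_iff.2 ⟨hx.1, fun e he hxe' => ?_⟩)
      rw [← hχ'ne e fun h => hxe (h ▸ hxe')]
      exact hx.2 e he hxe'
    have h1 := (card_le_card hsub).trans (card_union_le _ _)
    have h2 := card_toFinset_le_two e₁
    omega
  have hA' : ∀ c ∈ A, #(missing χ' R c) + 2 * T c + 2 ≤ #R := by
    intro c hc
    by_cases h : c = χ e₁
    · subst h
      omega
    · have := card_le_card (hsame c h)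
      have := hA c hc
      omega
  have hlt : #{c ∈ P | missing χ' R c = R} < k := by
    rw [← hk]
    refine card_lt_card ((ssubset_iff_of_subset fun c hc => ?_).2 ⟨c₀, hc₀, fun h => ?_⟩)
    · obtain ⟨hcP, hcR⟩ := mem_filter.1 hc
      refine mem_filter.2 ⟨hcP, ?_⟩
      by_cases h : c = χ e₁
      · subst h
        rw [hcR] at hgrow
        omega
      · exact missing_subset.antisymm (hcR.ge.trans (hsame c h))
    · have hR := (mem_filter.1 h).2
      induction e₁ with
      | h x y =>
        have hx : x ∈ missing χ' R c₀ := hR.ge (mk_mem_innerEdges.1 he₁).1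
        exact (mem_missing_iff.1 hx).2 _ he₁ (Sym2.mem_mk_left _ _) hχ'₁
  obtain ⟨χ'', h1, h2, h3, h4, h5⟩ := ih _ hlt χ' hproper rfl hA'
  exact ⟨χ'', h1, fun e he => (h2 e he).trans (hχ'ne e fun h => he₁F (h ▸ he)),
    fun c hc => (hmono c fun h => hc₀A (h ▸ hc)).trans (h3 c hc), h4, h5⟩

end Stealing

section Start

open Finset

variable {α : Type*} [DecidableEq V] [DecidableEq α]

/-- In every complete graph on `2 * m - 1` vertices with `2 * m - 1` colours, prescribed colours
on at most `m` edges extend to a proper edge coloring. -/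
def PrescriptionsExtend (V α : Type*) [DecidableEq V] (m : ℕ) : Prop :=
  ∀ (U : Finset V) (P : Finset α) (H : Finset (Sym2 V)) (col : Sym2 V → α),
    #U + 1 = 2 * m → #P + 1 = 2 * m → H ⊆ innerEdges U → (∀ e ∈ H, col e ∈ P) →
    (∀ e ∈ H, ∀ e' ∈ H, e ≠ e' → ∀ x ∈ e, x ∈ e' → col e ≠ col e') → #H ≤ m →
    ∃ χ : Sym2 V → α, ProperOn χ U P ∧ ∀ e ∈ H, χ e = col e

theorem ProperOn.card_missing_eq_one {g : Sym2 V → α} {R : Finset V} {Q : Finset α}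
    (hg : ProperOn g R Q) (hQ : #Q = #R) (hodd : #R % 2 = 1) {c : α} (hc : c ∈ Q) :
    #(missing g R c) = 1 := by
  have h1 := hg.sum_card_missing
  rw [hQ, mul_add, mul_one, add_comm, Nat.add_left_cancel_iff] at h1
  have h2 : ∀ c ∈ Q, 1 ≤ #(missing g R c) := fun c _ => by
    have := hg.card_missing_mod_two c
    omega
  exact ((sum_eq_sum_iff_of_le h2).1 (by simp [h1, hQ]) c hc).symm

variable [Nonempty α] {R : Finset V} {P : Finset α} {F₀ : Finset (Sym2 V)} {col : Sym2 V → α}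
  {F S : Finset V} {nb : V → V} {κ : V → α} {m ρ : ℕ}

theorem PrescriptionsExtend.exists_start (hext : PrescriptionsExtend V α m)
    (hR : #R + 1 = 2 * m) (hP : #P + 2 * ρ + 3 = 4 * m) (hF₀ : F₀ ⊆ innerEdges R)
    (hcol : ∀ e ∈ F₀, col e ∈ P)
    (hne : ∀ e ∈ F₀, ∀ e' ∈ F₀, e ≠ e' → ∀ x ∈ e, x ∈ e' → col e ≠ col e')
    (hF : ∀ w ∈ F, nb w ∈ R ∧ κ w ∈ P) (hFe : ∀ w ∈ F, ∀ e ∈ F₀, nb w ∈ e → col e ≠ κ w)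
    (hfp : #F + #S + ρ + 1 ≤ m) (hcard : #F₀ + #F + #S + ρ + 1 ≤ 2 * m) :
    ∃ χ : Sym2 V → α, ProperOn χ R P ∧ (∀ e ∈ F₀, χ e = col e) ∧
      (∀ w ∈ F, κ w ∈ freeColors χ R P (nb w)) ∧
      ∀ c ∈ P, 0 < #{u ∈ S | κ u = c} + #{w ∈ F | κ w = c} →
        #(missing χ R c) + 2 * #{u ∈ S | κ u = c} + 2 * #{w ∈ F | κ w ≠ c} + #R ≤ #P + 1 := by
  obtain ⟨F₁, hF₁, hF₁c⟩ := exists_subset_card_eq (min_le_left #F₀ m)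
  have hAP : {c ∈ P | c ∈ (S ∪ F).image κ} ∪ F₁.image col ⊆ P :=
    union_subset (filter_subset _ _) (image_subset_iff.2 fun e he => hcol e (hF₁ he))
  have hAc : #({c ∈ P | c ∈ (S ∪ F).image κ} ∪ F₁.image col) ≤ 2 * m - 1 := by
    have h1 := card_union_le {c ∈ P | c ∈ (S ∪ F).image κ} (F₁.image col)
    have h2 : #{c ∈ P | c ∈ (S ∪ F).image κ} ≤ #((S ∪ F).image κ) :=
      card_le_card fun c hc => (mem_filter.1 hc).2
    have h3 : #((S ∪ F).image κ) ≤ #(S ∪ F) := card_image_le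
    have h4 := card_union_le S F
    have h5 : #(F₁.image col) ≤ #F₁ := card_image_le
    omega
  obtain ⟨Q, hAQ, hQP, hQ⟩ := exists_subsuperset_card_eq hAP hAc (by omega)
  obtain ⟨g, hg, hgF⟩ := hext R Q F₁ col hR (by omega) (hF₁.trans hF₀)
    (fun e he => hAQ (mem_union_right _ (mem_image_of_mem _ he)))
    (fun e he e' he' => hne e (hF₁ he) e' (hF₁ he')) (by omega)
  have hκQ : ∀ w ∈ S ∪ F, κ w ∈ P → κ w ∈ Q := fun w hw hwP =>
    hAQ (mem_union_left _ (mem_filter.2 ⟨hwP, mem_image_of_mem _ hw⟩))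
  have hu : #(F₀ \ F₁) = #F₀ - #F₁ := card_sdiff_of_subset hF₁
  obtain ⟨χ, h1, h2, h3, h4⟩ := hg.exists_recoloring hQP hF₀ hcol hne hgF (F := F) (nb := nb)
    (κ := κ) (fun w hw => ⟨(hF w hw).1, hκQ w (mem_union_right _ hw) (hF w hw).2⟩) hFe (by omega)
  refine ⟨χ, h1, h2, h3, fun c hc hact => ?_⟩
  have hcQ : c ∈ Q := by
    rcases Nat.eq_zero_or_pos #{u ∈ S | κ u = c} with h | h
    · obtain ⟨w, hw⟩ := card_pos.1 (by omega : 0 < #{w ∈ F | κ w = c})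
      obtain ⟨hwm, rfl⟩ := mem_filter.1 hw
      exact hκQ w (mem_union_right _ hwm) hc
    · obtain ⟨w, hw⟩ := card_pos.1 h
      obtain ⟨hwm, rfl⟩ := mem_filter.1 hw
      exact hκQ w (mem_union_left _ hwm) hc
  have h5 := h4 c hcQ
  rw [hg.card_missing_eq_one (by omega) (by omega) hcQ] at h5
  have h6 := card_filter_add_card_filter_not (s := F) (fun w => κ w = c)
  have h7 : #{u ∈ S | κ u = c} ≤ #S := card_filter_le _ _
  simp only [ne_eq] at h6 ⊢
  omega

theorem PrescriptionsExtend.exists_start_all_used (hext : PrescriptionsExtend V α m)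
    (hR : #R + 1 = 2 * m) (hP : #P + 2 * ρ + 3 = 4 * m) (hρ : ρ ≤ 1) (hm : 2 + ρ ≤ m)
    (hF₀ : F₀ ⊆ innerEdges R) (hcol : ∀ e ∈ F₀, col e ∈ P)
    (hne : ∀ e ∈ F₀, ∀ e' ∈ F₀, e ≠ e' → ∀ x ∈ e, x ∈ e' → col e ≠ col e')
    (hF : ∀ w ∈ F, nb w ∈ R ∧ κ w ∈ P) (hFe : ∀ w ∈ F, ∀ e ∈ F₀, nb w ∈ e → col e ≠ κ w)
    (hfp : #F + #S + ρ + 1 ≤ m) (hcard : #F₀ + #F + #S + ρ + 1 ≤ 2 * m) :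
    ∃ χ : Sym2 V → α, ProperOn χ R P ∧ (∀ e ∈ F₀, χ e = col e) ∧
      (∀ w ∈ F, κ w ∈ freeColors χ R P (nb w)) ∧
      (∀ c ∈ P, #(missing χ R c) + #R ≤ #P + 1) ∧
      ∀ c ∈ P, 0 < #{u ∈ S | κ u = c} + #{w ∈ F | κ w = c} →
        #(missing χ R c) + 2 * #{u ∈ S | κ u = c} + 2 * #{w ∈ F | κ w ≠ c} + #R ≤ #P + 1 := by
  obtain ⟨χ, h1, h2, h3, h4⟩ := hext.exists_start hR hP hF₀ hcol hne hF hFe hfp hcard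
  obtain rfl | rfl : ρ = 0 ∨ ρ = 1 := by omega
  · refine ⟨χ, h1, h2, h3, fun c _ => ?_, h4⟩
    have := card_le_card (missing_subset (χ := χ) (R := R) (c := c))
    omega
  set A : Finset α := {c ∈ P | 0 < #{u ∈ S | κ u = c} + #{w ∈ F | κ w = c}} with hA
  have hAc : #A ≤ #F + #S := by
    have hsub : A ⊆ (F ∪ S).image κ := by
      intro c hc
      obtain ⟨-, hc⟩ := mem_filter.1 hc
      rcases Nat.eq_zero_or_pos #{u ∈ S | κ u = c} with h | h
      · obtain ⟨w, hw⟩ := card_pos.1 (by omega : 0 < #{w ∈ F | κ w = c})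
        obtain ⟨hwm, rfl⟩ := mem_filter.1 hw
        exact mem_image_of_mem _ (mem_union_left _ hwm)
      · obtain ⟨w, hw⟩ := card_pos.1 h
        obtain ⟨hwm, rfl⟩ := mem_filter.1 hw
        exact mem_image_of_mem _ (mem_union_right _ hwm)
    exact ((card_le_card hsub).trans card_image_le).trans (card_union_le _ _)
  set T : α → ℕ := fun c => if c ∈ A then #{u ∈ S | κ u = c} + #{w ∈ F | κ w ≠ c} else 0 with hT
  have hTA : ∀ c ∈ A, T c = #{u ∈ S | κ u = c} + #{w ∈ F | κ w ≠ c} := fun c hc => if_pos hc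
  have hTs : ∑ c ∈ P, T c ≤ #S + (#F + #S) * #F := by
    rw [hT, ← sum_filter, filter_mem_eq_inter, inter_eq_right.2 (filter_subset _ _),
      sum_add_distrib]
    refine Nat.add_le_add ?_ ((sum_le_card_nsmul A _ #F fun c _ => card_filter_le _ _).trans
      (Nat.mul_le_mul_right _ hAc))
    rw [sum_card_fiberwise_eq_card_filter]
    exact card_filter_le _ _
  obtain ⟨χ', h1', h2', h3', h4', h5'⟩ := ProperOn.exists_all_colors_used (A := A) (T := T) hF₀
    (by omega) (by
      obtain ⟨q, rfl⟩ : ∃ q, m = q + 3 := ⟨m - 3, by omega⟩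
      obtain ⟨hR', hP'⟩ : #R = 2 * q + 5 ∧ #P = 4 * q + 7 := by omega
      have hSS : #S ≤ #S * #S := Nat.le_mul_self _
      have hK : #F + #S ≤ q + 1 := by omega
      have hF₀' : 2 * (#F₀ - 1) + 2 * (#F + #S) ≤ 4 * q + 6 := by omega
      rw [hR', hP']
      simp only [show 4 * q + 7 - 1 = 4 * q + 6 by omega]
      nlinarith) _ χ h1 rfl fun c hc => by
        have := h4 c (mem_filter.1 hc).1 (mem_filter.1 hc).2
        rw [hTA c hc]
        omega
  refine ⟨χ', h1', fun e he => (h2' e he).trans (h2 e he), fun w hw => ?_, fun c hc => ?_,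
    fun c hc hact => ?_⟩
  · obtain ⟨hwR, hwP⟩ := hF w hw
    have hwA : κ w ∈ A := mem_filter.2 ⟨hwP, Nat.add_pos_right _
      (card_pos.2 ⟨w, mem_filter.2 ⟨hw, rfl⟩⟩)⟩
    have h6 := h3 w hw
    rw [mem_freeColors_iff hwR] at h6 ⊢
    exact ⟨hwP, (mem_missing_iff.1 (h3' _ hwA (mem_missing_iff.2 ⟨hwR, h6.2⟩))).2⟩
  · have := h5' c hc
    omega
  · have hcA : c ∈ A := mem_filter.2 ⟨hc, hact⟩
    have := h4' c hcA
    rw [hTA c hcA] at this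
    omega

end Start

section LowDegree

open Finset

variable [DecidableEq V]

theorem sum_card_filter_mem_edge {U : Finset V} {H : Finset (Sym2 V)} (hH : H ⊆ innerEdges U) :
    ∑ v ∈ U, #{e ∈ H | v ∈ e} = 2 * #H := by
  change ∑ v ∈ U, #(bipartiteAbove (fun v e => v ∈ e) H v) = _
  rw [sum_card_bipartiteAbove_eq_sum_card_bipartiteBelow (s := U) (t := H) (fun v e => v ∈ e),
    mul_comm, ← smul_eq_mul, ← sum_const]
  refine sum_congr rfl fun e he => ?_
  obtain ⟨h1, h2⟩ := mem_innerEdges.1 (hH he)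
  have h3 : bipartiteBelow (fun v e => v ∈ e) U e = e.toFinset := by
    ext v
    simpa [bipartiteBelow] using h1 v
  rw [h3, Sym2.card_toFinset, if_neg h2]

/-- A sparse graph has many vertices of degree at most one: we find a set `W` of `k` such vertices,
in which every edge of `H` meeting `W` is either an edge from `F ⊆ W` to the outside,
or one of the isolated edges at `S ⊆ W`. -/
theorem exists_low_degree_set {U : Finset V} {H : Finset (Sym2 V)} {n k : ℕ}
    (hU : #U + 1 = 2 * n) (hH : H ⊆ innerEdges U) (hHn : #H ≤ n) (hk : k % 2 = 0)
    (hkn : k + 1 ≤ n) :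
    ∃ (W F S : Finset V) (nb : V → V), W ⊆ U ∧ #W = k ∧ F ⊆ W ∧ S ⊆ W ∧ Disjoint F S ∧
      Set.InjOn nb S ∧ (∀ u ∈ S, nb u ∈ W ∧ nb u ∉ S ∧ nb u ∉ F ∧ s(u, nb u) ∈ H) ∧
      (∀ w ∈ F, nb w ∈ U \ W ∧ s(w, nb w) ∈ H) ∧ 2 * #F + 2 * #S ≤ k ∧
      ∀ e ∈ H, e ∈ innerEdges (U \ W) ∨ ∃ w ∈ F ∪ S, e = s(w, nb w) := by
  set deg : V → ℕ := fun v => #{e ∈ H | v ∈ e} with hdeg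
  set D₀ : Finset V := {v ∈ U | deg v = 0} with hD₀
  set D₁ : Finset V := {v ∈ U | deg v = 1} with hD₁
  set D₂ : Finset V := {v ∈ U | 2 ≤ deg v} with hD₂
  have hex : ∀ v ∈ D₁, ∃ y ∈ U, y ≠ v ∧ s(v, y) ∈ H ∧ ∀ e ∈ H, v ∈ e → e = s(v, y) := by
    intro v hv
    obtain ⟨e, he⟩ := card_eq_one.1 (mem_filter.1 hv).2
    have heH := mem_filter.1 (he.ge (mem_singleton_self e))
    obtain ⟨y, hy, hyv, rfl⟩ := exists_eq_mk_of_mem_innerEdges (hH heH.1) heH.2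
    refine ⟨y, hy, hyv, heH.1, fun e' he' hve' => ?_⟩
    rw [← mem_singleton, ← he, mem_filter]
    exact ⟨he', hve'⟩
  choose! nb hnbU hnbne hnbH hnbu using hex
  set K : Finset V := {v ∈ D₁ | nb v ∈ D₁} with hK
  set L : Finset V := {v ∈ D₁ | nb v ∉ D₁} with hL
  have hinv : ∀ v ∈ K, nb (nb v) = v := by
    intro v hv
    obtain ⟨h1, h2⟩ := mem_filter.1 hv
    have h3 := hnbu _ h2 _ (hnbH v h1) (Sym2.mem_mk_right _ _)
    rw [Sym2.eq_swap] at h3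
    exact (Sym2.congr_right.1 h3).symm
  have hnbK : ∀ v ∈ K, nb v ∈ K := by
    intro v hv
    refine mem_filter.2 ⟨(mem_filter.1 hv).2, ?_⟩
    rw [hinv v hv]
    exact (mem_filter.1 hv).1
  have hKinj : Set.InjOn nb K := by
    intro v hv w hw h
    rw [← hinv v hv, ← hinv w hw, h]
  have hLD₂ : ∀ v ∈ L, nb v ∈ D₂ := by
    intro v hv
    obtain ⟨h1, h2⟩ := mem_filter.1 hv
    have h3 : deg (nb v) ≠ 1 := fun h => h2 (mem_filter.2 ⟨hnbU v h1, h⟩)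
    have h4 : 0 < deg (nb v) :=
      card_pos.2 ⟨_, mem_filter.2 ⟨hnbH v h1, Sym2.mem_mk_right _ _⟩⟩
    exact mem_filter.2 ⟨hnbU v h1, by omega⟩
  obtain ⟨f, -, hf⟩ := exists_injOn_of_card_le (s := U) (t := range #U) (by simp)
  set E : Finset V := {v ∈ K | f v < f (nb v)} with hE
  have hKU : ∀ v ∈ K, v ∈ U := fun v hv => (mem_filter.1 (mem_filter.1 hv).1).1
  have hEK : E ⊆ K := filter_subset _ _
  have hEnot : ∀ u ∈ E, nb u ∉ E := by
    intro u hu h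
    have h1 := (mem_filter.1 hu).2
    have h2 := (mem_filter.1 h).2
    rw [hinv u (hEK hu)] at h2
    omega
  have hKcard : #K = 2 * #E := by
    have h1 : K = E ∪ E.image nb := by
      ext v
      refine ⟨fun hv => ?_, fun hv => ?_⟩
      · rcases lt_trichotomy (f v) (f (nb v)) with h | h | h
        · exact mem_union_left _ (mem_filter.2 ⟨hv, h⟩)
        · exact absurd (hf (hKU v hv) (hKU _ (hnbK v hv)) h).symm (hnbne v (mem_filter.1 hv).1)
        · refine mem_union_right _ (mem_image.2 ⟨nb v, mem_filter.2 ⟨hnbK v hv, ?_⟩, hinv v hv⟩)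
          rwa [hinv v hv]
      · rcases mem_union.1 hv with h | h
        · exact hEK h
        · obtain ⟨u, hu, rfl⟩ := mem_image.1 h
          exact hnbK u (hEK hu)
    rw [h1, card_union_of_disjoint, card_image_of_injOn (hKinj.mono hEK)]
    · omega
    · refine Finset.disjoint_left.2 fun v hv h => ?_
      obtain ⟨u, hu, rfl⟩ := mem_image.1 h
      exact hEnot u hu hv
  have hKL : #K + #L = #D₁ := card_filter_add_card_filter_not _
  have hsum : ∑ v ∈ U, deg v = 2 * #H := sum_card_filter_mem_edge hH
  have hU₁ : #D₀ + #{v ∈ U | ¬ deg v = 0} = #U := card_filter_add_card_filter_not _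
  have hU₂ := card_filter_add_card_filter_not (s := {v ∈ U | ¬ deg v = 0}) (fun v => deg v = 1)
  have e₁ : ({v ∈ {v ∈ U | ¬ deg v = 0} | deg v = 1} : Finset V) = D₁ := by
    ext v
    simp only [hD₁, mem_filter]
    exact ⟨fun h => ⟨h.1.1, h.2⟩, fun h => ⟨⟨h.1, by omega⟩, h.2⟩⟩
  have e₂ : ({v ∈ {v ∈ U | ¬ deg v = 0} | ¬ deg v = 1} : Finset V) = D₂ := by
    ext v
    simp only [hD₂, mem_filter]
    exact ⟨fun h => ⟨h.1.1, by omega⟩, fun h => ⟨⟨h.1, by omega⟩, by omega⟩⟩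
  have hs : ∑ v ∈ U, deg v = #D₁ + ∑ v ∈ D₂, deg v := by
    rw [← sum_filter_add_sum_filter_not U (fun v => deg v = 0),
      ← sum_filter_add_sum_filter_not {v ∈ U | ¬ deg v = 0} (fun v => deg v = 1), e₁, e₂,
      sum_eq_zero fun v hv => (mem_filter.1 hv).2, zero_add,
      sum_const_nat fun v hv => (mem_filter.1 hv).2, mul_one]
  rw [e₁, e₂] at hU₂
  have hs₂ : 2 * #D₂ ≤ ∑ v ∈ D₂, deg v := by
    rw [mul_comm, ← smul_eq_mul]
    exact card_nsmul_le_sum _ _ _ fun v hv => (mem_filter.1 hv).2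
  have hsL : #L ≤ ∑ v ∈ D₂, deg v := by
    rw [card_eq_sum_card_fiberwise hLD₂]
    refine sum_le_sum fun y _ => card_le_card_of_injOn (fun v => s(v, nb v)) ?_ ?_
    · intro v hv
      obtain ⟨hvL, rfl⟩ := mem_filter.1 hv
      exact mem_filter.2 ⟨hnbH v (mem_filter.1 hvL).1, Sym2.mem_mk_right _ _⟩
    · intro v hv w hw h
      have hv' := (mem_filter.1 hv).2
      have hw' := (mem_filter.1 hw).2
      simp only [hv', hw'] at h
      exact Sym2.congr_left.1 h
  obtain ⟨p, z, q, hp, hz, hq, hpk, hqz⟩ : ∃ p z q, p ≤ #E ∧ z ≤ #D₀ ∧ q ≤ #L ∧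
      q + 2 * p + z = k ∧ q ≤ z := by
    by_cases h : k ≤ 2 * #E + #D₀
    · refine ⟨min #E (k / 2), k - 2 * min #E (k / 2), 0, ?_, ?_, ?_, ?_, ?_⟩ <;> omega
    · refine ⟨#E, #D₀, k - 2 * #E - #D₀, ?_, ?_, ?_, ?_, ?_⟩ <;> omega
  obtain ⟨S, hSE, rfl⟩ := exists_subset_card_eq hp
  obtain ⟨Z, hZD, rfl⟩ := exists_subset_card_eq hz
  obtain ⟨F, hFL, rfl⟩ := exists_subset_card_eq hq
  have hSK : S ⊆ K := hSE.trans hEK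
  have hKD : ∀ v ∈ K, deg v = 1 := fun v hv => (mem_filter.1 (mem_filter.1 hv).1).2
  have hLD : ∀ v ∈ L, deg v = 1 := fun v hv => (mem_filter.1 (mem_filter.1 hv).1).2
  have hKnL : ∀ v ∈ K, v ∉ L := fun v hv h => (mem_filter.1 h).2 (mem_filter.1 hv).2
  have hZdeg : ∀ v ∈ Z, deg v = 0 := fun v hv => (mem_filter.1 (hZD hv)).2
  have hFS : Disjoint F S := Finset.disjoint_left.2 fun v hv h => hKnL v (hSK h) (hFL hv)
  have hSN : Disjoint S (S.image nb) := Finset.disjoint_left.2 fun v hv h => by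
    obtain ⟨u, hu, rfl⟩ := mem_image.1 h
    exact hEnot u (hSE hu) (hSE hv)
  have hNK : ∀ v ∈ S.image nb, v ∈ K := fun v hv => by
    obtain ⟨u, hu, rfl⟩ := mem_image.1 hv
    exact hnbK u (hSK hu)
  have hWdeg : ∀ v ∈ F ∪ (S ∪ S.image nb) ∪ Z, v ∈ U ∧ deg v ≤ 1 := by
    intro v hv
    simp only [mem_union] at hv
    rcases hv with (h | h | h) | h
    · exact ⟨(mem_filter.1 (mem_filter.1 (hFL h)).1).1, (hLD v (hFL h)).le⟩
    · exact ⟨hKU v (hSK h), (hKD v (hSK h)).le⟩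
    · exact ⟨hKU v (hNK v h), (hKD v (hNK v h)).le⟩
    · exact ⟨(mem_filter.1 (hZD h)).1, by rw [hZdeg v h]; omega⟩
  refine ⟨F ∪ (S ∪ S.image nb) ∪ Z, F, S, nb, fun v hv => (hWdeg v hv).1, ?_, ?_, ?_, hFS,
    hKinj.mono hSK, fun u hu => ⟨?_, ?_, ?_, hnbH u (mem_filter.1 (hSK hu)).1⟩,
    fun w hw => ⟨mem_sdiff.2 ⟨hnbU w (mem_filter.1 (hFL hw)).1, fun h => ?_⟩,
      hnbH w (mem_filter.1 (hFL hw)).1⟩, by omega, fun e he => ?_⟩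
  · rw [card_union_of_disjoint, card_union_of_disjoint, card_union_of_disjoint hSN,
      card_image_of_injOn (hKinj.mono hSK)]
    · omega
    · refine Finset.disjoint_left.2 fun v hv h => ?_
      rcases mem_union.1 h with h | h
      · exact hKnL v (hSK h) (hFL hv)
      · exact hKnL v (hNK v h) (hFL hv)
    · refine Finset.disjoint_left.2 fun v hv h => ?_
      have h0 := hZdeg v h
      simp only [mem_union] at hv
      rcases hv with h | h | h
      · have := hLD v (hFL h); omega
      · have := hKD v (hSK h); omega
      · have := hKD v (hNK v h); omega
  · exact subset_union_left.trans subset_union_left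
  · exact (subset_union_left.trans subset_union_right).trans subset_union_left
  · exact mem_union_left _ (mem_union_right _ (mem_union_right _ (mem_image_of_mem _ hu)))
  · exact fun h => hEnot u (hSE hu) (hSE h)
  · exact fun h => hKnL _ (hnbK u (hSK hu)) (hFL h)
  · have h1 := (hWdeg _ h).2
    have h2 := (mem_filter.1 (hLD₂ w (hFL hw))).2
    omega
  · by_cases h : ∃ v ∈ e, v ∈ F ∪ (S ∪ S.image nb) ∪ Z
    · right
      obtain ⟨v, hve, hv⟩ := h
      simp only [mem_union] at hv
      rcases hv with (h | h | h) | h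
      · exact ⟨v, mem_union_left _ h, hnbu v (mem_filter.1 (hFL h)).1 e he hve⟩
      · exact ⟨v, mem_union_right _ h, hnbu v (mem_filter.1 (hSK h)).1 e he hve⟩
      · have h1 := hnbu v (mem_filter.1 (hNK v h)).1 e he hve
        obtain ⟨u, hu, rfl⟩ := mem_image.1 h
        refine ⟨u, mem_union_right _ hu, ?_⟩
        rw [h1, hinv u (hSK hu), Sym2.eq_swap]
      · have h1 : 0 < deg v := card_pos.2 ⟨e, mem_filter.2 ⟨he, hve⟩⟩
        have := hZdeg v h
        omega
    · left
      push Not at h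
      obtain ⟨h1, h2⟩ := mem_innerEdges.1 (hH he)
      exact mem_innerEdges.2 ⟨fun x hx => mem_sdiff.2 ⟨h1 x hx, h x hx⟩, h2⟩

end LowDegree

section Main

open Finset

variable {α : Type*} [DecidableEq V] [Nonempty α]

theorem prescriptionsExtend_one : PrescriptionsExtend V α 1 := by
  intro U P H col hU _ hH _ _ _
  have hempty : innerEdges U = ∅ := by
    obtain ⟨a, rfl⟩ := card_eq_one.1 (by omega : #U = 1)
    refine eq_empty_of_forall_notMem fun e he => ?_
    induction e with
    | h x y =>
      obtain ⟨hx, hy, hxy⟩ := mk_mem_innerEdges.1 he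
      exact hxy ((mem_singleton.1 hx).trans (mem_singleton.1 hy).symm)
  obtain ⟨c⟩ := ‹Nonempty α›
  refine ⟨fun _ => c, properOn_iff.2 (by simp [hempty]), fun e he => ?_⟩
  have := hH he
  simp [hempty] at this

variable [DecidableEq α]

theorem prescriptionsExtend_two : PrescriptionsExtend V α 2 := by
  intro U P H col hU hP hH hcol hne hcard
  have hshare : ∀ e ∈ innerEdges U, ∀ e' ∈ innerEdges U, ∃ x ∈ e, x ∈ e' := by
    intro e he e' he'
    rw [mem_innerEdges] at he he'
    by_contra! hdis
    have h1 : #(e.toFinset ∪ e'.toFinset) = 4 := by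
      rw [card_union_of_disjoint, Sym2.card_toFinset, Sym2.card_toFinset, if_neg he.2, if_neg he'.2]
      exact Finset.disjoint_left.2 fun x hx => by simpa using hdis x (by simpa using hx)
    have h2 : e.toFinset ∪ e'.toFinset ⊆ U := union_subset
      (fun x hx => he.1 x (by simpa using hx)) (fun x hx => he'.1 x (by simpa using hx))
    have := card_le_card h2
    omega
  have hinner : #(innerEdges U) ≤ 3 := by
    obtain ⟨a, b, c, -, -, -, rfl⟩ := card_eq_three.1 (by omega : #U = 3)
    refine (card_le_card (t := {s(a, b), s(a, c), s(b, c)}) fun e he => ?_).trans card_le_three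
    induction e with
    | h x y =>
      rw [mk_mem_innerEdges] at he
      simp only [mem_insert, mem_singleton, Sym2.eq_iff] at he ⊢
      grind
  have hinj : Set.InjOn col H := fun e he e' he' h => by
    by_contra hee
    obtain ⟨x, hx, hx'⟩ := hshare e (hH he) e' (hH he')
    exact hne e he e' he' hee x hx hx' h
  obtain ⟨fr, hfr, hfri⟩ := exists_injOn_of_card_le
    (s := innerEdges U \ H) (t := P \ H.image col) (by
      rw [card_sdiff_of_subset hH, card_sdiff_of_subset (image_subset_iff.2 hcol),
        card_image_of_injOn hinj]
      omega)
  have hfrH : ∀ e ∈ innerEdges U \ H, ∀ e' ∈ H, col e' ≠ fr e := fun e he e' he' h =>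
    (mem_sdiff.1 (hfr e he)).2 (h ▸ mem_image_of_mem _ he')
  refine ⟨fun e => if e ∈ H then col e else fr e, properOn_iff.2
    ⟨fun e he => ?_, fun e he e' he' hee x hx hx' => ?_⟩, fun e he => if_pos he⟩
  · split_ifs with h
    · exact hcol e h
    · exact (mem_sdiff.1 (hfr e (mem_sdiff.2 ⟨he, h⟩))).1
  · split_ifs with h h' h'
    · exact hne e h e' h' hee x hx hx'
    · exact hfrH e' (mem_sdiff.2 ⟨he', h'⟩) e h
    · exact (hfrH e (mem_sdiff.2 ⟨he, h⟩) e' h').symm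
    · exact fun heq => hee (hfri (mem_coe.2 (mem_sdiff.2 ⟨he, h⟩))
        (mem_coe.2 (mem_sdiff.2 ⟨he', h'⟩)) heq)

theorem prescriptionsExtend_of_pos (n : ℕ) (hn : 0 < n) : PrescriptionsExtend V α n := by
  induction n using Nat.strong_induction_on with
  | _ n ih =>
  obtain rfl | rfl | hn3 : n = 1 ∨ n = 2 ∨ 3 ≤ n := by omega
  · exact prescriptionsExtend_one
  · exact prescriptionsExtend_two
  obtain ⟨m, ρ, hρ, hm, hnm⟩ : ∃ m ρ, ρ ≤ 1 ∧ 2 + ρ ≤ m ∧ n + 1 + ρ = 2 * m :=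
    ⟨(n + 2) / 2, 2 * ((n + 2) / 2) - 1 - n, by omega, by omega, by omega⟩
  intro U P H col hU hP hH hcol hne hcard
  obtain ⟨W, F, S, nb, hWU, hW, hFW, hSW, hFS, hinj, hS, hF, hFSk, hedge⟩ :=
    exists_low_degree_set (k := 2 * (m - 1 - ρ)) hU hH hcard (by omega) (by omega)
  have hR : #(U \ W) + 1 = 2 * m := by
    rw [card_sdiff_of_subset hWU]
    omega
  have hnbH : ∀ w ∈ F ∪ S, s(w, nb w) ∈ H := fun w hw =>
    (mem_union.1 hw).elim (fun h => (hF w h).2) (fun h => (hS w h).2.2.2)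
  have hout : ∀ w ∈ W, ∀ e ∈ innerEdges (U \ W), w ∉ e := fun w hw e he hwe =>
    (mem_sdiff.1 ((mem_innerEdges.1 he).1 w hwe)).2 hw
  have hFSW : ∀ w ∈ F ∪ S, w ∈ W := fun w hw => (mem_union.1 hw).elim (@hFW w) (@hSW w)
  have hcount : #{e ∈ H | e ∈ innerEdges (U \ W)} + #F + #S ≤ #H := by
    have h1 : #(F ∪ S) ≤ #{e ∈ H | e ∉ innerEdges (U \ W)} := by
      refine card_le_card_of_injOn (fun w => s(w, nb w)) (fun w hw => mem_filter.2 ⟨hnbH w hw,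
        fun h => hout w (hFSW w hw) _ h (Sym2.mem_mk_left _ _)⟩) fun w hw w' hw' h => ?_
      rcases Sym2.eq_iff.1 h with h | ⟨h, h'⟩
      · exact h.1
      · exfalso
        rcases mem_union.1 hw with hwF | hwS
        · exact (mem_sdiff.1 (hF w hwF).1).2 (h' ▸ hFSW w' hw')
        · rcases mem_union.1 hw' with h2 | h2
          · exact (hS w hwS).2.2.1 (h' ▸ h2)
          · exact (hS w hwS).2.1 (h' ▸ h2)
    have h2 := card_filter_add_card_filter_not (s := H) (fun e => e ∈ innerEdges (U \ W))
    rw [card_union_of_disjoint hFS] at h1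
    omega
  obtain ⟨χ, h1, h2, h3, h4, h5⟩ := (ih m (by omega) (by omega)).exists_start_all_used
    (R := U \ W) (P := P) (F₀ := {e ∈ H | e ∈ innerEdges (U \ W)}) (col := col) (F := F) (S := S)
    (nb := nb) (κ := fun w => col s(w, nb w)) hR (by omega) hρ hm
    (fun e he => (mem_filter.1 he).2) (fun e he => hcol e (mem_filter.1 he).1)
    (fun e he e' he' => hne e (mem_filter.1 he).1 e' (mem_filter.1 he').1)
    (fun w hw => ⟨(hF w hw).1, hcol _ (hF w hw).2⟩)
    (fun w hw e he hwe => hne e (mem_filter.1 he).1 _ (hF w hw).2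
      (fun h => hout w (hFW hw) e (mem_filter.1 he).2 (h ▸ Sym2.mem_mk_left _ _)) _ hwe
      (Sym2.mem_mk_right _ _)) (by omega) (by omega)
  have hWR : W = U \ (U \ W) := by rw [sdiff_sdiff_right_self, inf_eq_inter, inter_eq_right.2 hWU]
  obtain ⟨χ', h1', h2', h3', h4'⟩ := ProperOn.exists_extension_prescribed (U := U) (P := P)
    (by omega) (by omega) nb (fun w => col s(w, nb w)) S hinj #F (U \ W) F χ sdiff_subset h1 rfl
    (hWR ▸ hFW) (hWR ▸ hSW) hFS
    (fun u hu => ⟨hWR ▸ (hS u hu).1, (hS u hu).2.1, (hS u hu).2.2.1, hcol _ (hS u hu).2.2.2⟩)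
    (fun w hw => ⟨(hF w hw).1, h3 w hw⟩)
    (fun w hw w' hw' hww h => hne _ (hF w hw).2 _ (hF w' hw').2
      (fun he => hww (by rw [h] at he; exact Sym2.congr_left.1 he)) (nb w) (Sym2.mem_mk_right _ _)
      (h ▸ Sym2.mem_mk_right _ _)) h4 h5
  refine ⟨χ', h1', fun e he => ?_⟩
  rcases hedge e he with hin | ⟨w, hw, rfl⟩
  · rw [← h2 e (mem_filter.2 ⟨he, hin⟩)]
    induction e with
    | h x y =>
      obtain ⟨hx, hy, hxy⟩ := mk_mem_innerEdges.1 hin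
      exact h2' x hx y hy hxy
  · exact (mem_union.1 hw).elim (h4' w) (h3' w)

end Main

theorem stmt11 (n : ℕ) (hn : 2 ≤ n) (φ : Sym2 (Fin (2*n-1)) → Option ℕ)
    (hφ : IsPartialProperEdgeColoring ⊤ φ) (hc : UsesColors φ (2*n-1))
    (hcard : (Precolored φ).ncard ≤ n) :
    Extendable (⊤ : SimpleGraph (Fin (2*n-1))) φ (2*n-1) := by
  have hinner : ∀ e : Sym2 (Fin (2*n-1)), e ∈ innerEdges Finset.univ ↔
      e ∈ (⊤ : SimpleGraph (Fin (2*n-1))).edgeSet := fun e => by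
    simp [mem_innerEdges]
  have hget : ∀ e, φ e ≠ none → φ e = some ((φ e).getD 0) := fun e he => by
    obtain ⟨a, ha⟩ := Option.ne_none_iff_exists'.1 he
    simp [ha]
  obtain ⟨C, hC, hCφ⟩ := prescriptionsExtend_of_pos (V := Fin (2*n-1)) (α := ℕ) n (by omega)
    Finset.univ (Finset.range (2*n-1)) (Finset.univ.filter fun e => φ e ≠ none)
    (fun e => (φ e).getD 0) (by simp; omega) (by simp; omega)
    (fun e he => (hinner e).2 (hφ.1 e (Finset.mem_filter.1 he).2))
    (fun e he => Finset.mem_range.2 (hc e _ (hget e (Finset.mem_filter.1 he).2)))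
    (fun e he e' he' hee x hx hx' h => by
      have h1 := (Finset.mem_filter.1 he).2
      have h2 := (Finset.mem_filter.1 he').2
      refine hφ.2 ⟨hφ.1 e h1, hφ.1 e' h2, hee, x, hx, hx'⟩ h1 ?_
      rw [hget e h1, hget e' h2, h])
    (by
      rw [← Set.ncard_coe_finset]
      simpa [Precolored] using hcard)
  obtain ⟨hmem, hne⟩ := properOn_iff.1 hC
  refine ⟨C, fun e f h => ?_, fun e he => Finset.mem_range.1 (hmem e ((hinner e).2 he)),
    fun e a ha => ?_⟩
  · obtain ⟨he, hf, hef, x, hx, hx'⟩ := h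
    exact hne e ((hinner e).2 he) f ((hinner f).2 hf) hef x hx hx'
  · rw [hCφ e (Finset.mem_filter.2 ⟨Finset.mem_univ e, by simp [ha]⟩), ha]
    rfl
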